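/- There exists an absolute constant C > 0 with the following property: for every odd prime p, if for every Dirichlet character ψ modulo p every zero s of L(s,ψ) with 0 < Re(s) < 1 satisfies Re(s) = 1/2, then for all real x ≥ 8 one has | N_S(p,x) − (φ(p−1)/(p−1)) · ∑_{r ≤ x^{1/3}, r prime} (χ₀(r) − χ₂(r)) · Li(x^{1/2}/r^{3/2}) | ≤ C · (φ(p−1)/(p−1)) · 2^{ω(p−1)} · x^{1/3} · (log(p·x))², where N_S(p,x) is the number of integers in S ∩ [1,x] that are primitive roots modulo p. -/

import Mathlib

/-- The logarithmic integral `Li(y) = ∫_2^y dt / log t`, taken to be `0` for `y ≤ 2`. -/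
noncomputable def Li (y : ℝ) : ℝ := if y ≤ 2 then 0 else ∫ t in (2 : ℝ)..y, 1 / Real.log t

/-- `S` is the set of positive integers of the form `q² r³` with `q, r` prime. -/
def memS (m : ℕ) : Prop := ∃ q r : ℕ, q.Prime ∧ r.Prime ∧ m = q ^ 2 * r ^ 3

section LogDerivative

open Complex Metric

/-- A zero-free holomorphic function on a disc has a holomorphic logarithm of `f / f c`. -/
theorem exists_log_of_ne_zero_on_ball {f : ℂ → ℂ} {c : ℂ} {r : ℝ} (hr : 0 < r)
    (hf : Differentiable ℂ f) (hne : ∀ s ∈ ball c r, f s ≠ 0) :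
    ∃ g : ℂ → ℂ, g c = 0 ∧ (∀ s ∈ ball c r, HasDerivAt g (deriv f s / f s) s) ∧
      ∀ s ∈ ball c r, f s = f c * exp (g s) := by
  have hd : DifferentiableOn ℂ (fun s ↦ deriv f s / f s) (ball c r) := fun s hs ↦
    ((hf.deriv s).div (hf s) (hne s hs)).differentiableWithinAt
  obtain ⟨g, hg0, hg⟩ := hd.isExactOn_ball.with_val_at c 0
  refine ⟨g, hg0, hg, fun s hs ↦ ?_⟩
  have hder : ∀ x ∈ ball c r, HasDerivAt (fun s ↦ f s * exp (-g s)) 0 x := fun x hx ↦ by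
    convert! (hf x).hasDerivAt.mul (hg x hx).neg.cexp using 1
    have := hne x hx
    field_simp
    ring
  have hconst := (convex_ball c r).is_const_of_fderivWithin_eq_zero (𝕜 := ℂ)
    (f := fun s ↦ f s * exp (-g s))
    (fun x hx ↦ (hder x hx).differentiableAt.differentiableWithinAt)
    (fun x hx ↦ by
      rw [fderivWithin_of_isOpen isOpen_ball hx]
      ext
      simp [(hder x hx).deriv])
    hs (mem_ball_self hr)
  simp only [hg0, neg_zero, exp_zero, mul_one] at hconst
  rw [← hconst, mul_assoc, ← exp_add]
  simp

/-- A zero-free function on `Re s > 1/2` of polynomial growth, bounded below on `Re s = 2`,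
has logarithmic derivative of logarithmic growth inside the half-plane. -/
theorem norm_logDeriv_le_of_growth {f : ℂ → ℂ} (hf : Differentiable ℂ f)
    (hne : ∀ s : ℂ, 1 / 2 < s.re → f s ≠ 0) {A : ℝ} (hA : 1 ≤ A)
    (hgrow : ∀ s : ℂ, 1 / 2 < s.re → ‖f s‖ ≤ A * (1 + ‖s‖) ^ 2)
    (hlow : ∀ s : ℂ, s.re = 2 → 1 / 4 ≤ ‖f s‖) {s : ℂ} (hs : 3 / 5 ≤ s.re) (hs2 : s.re ≤ 2) :
    ‖deriv f s / f s‖ ≤ 1160 * Real.log (4 * A * (5 + |s.im|) ^ 2) := by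
  set c : ℂ := ⟨2, s.im⟩ with hc
  have hball : ∀ z ∈ ball c (3 / 2), 1 / 2 < z.re := fun z hz ↦ by
    have h1 := (abs_re_le_norm (z - c)).trans_lt (mem_ball_iff_norm.mp hz)
    simp only [sub_re, hc] at h1
    linarith [(abs_lt.mp h1).1]
  obtain ⟨g, hg0, hg, hfg⟩ := exists_log_of_ne_zero_on_ball (c := c) (r := 3 / 2) (by norm_num) hf
    fun z hz ↦ hne z (hball z hz)
  set M := Real.log (4 * A * (5 + |s.im|) ^ 2) with hM
  have habs := abs_nonneg s.im
  have hB : 1 < 4 * A * (5 + |s.im|) ^ 2 := by nlinarith [sq_nonneg (|s.im|)]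
  have hMpos : 0 < M := Real.log_pos hB
  have hcn : ‖c‖ ≤ 2 + |s.im| := by
    refine (norm_le_abs_re_add_abs_im c).trans ?_
    simp [hc]
  have hre : ∀ z ∈ ball c (3 / 2), (g z).re ≤ M := fun z hz ↦ by
    have h1 := hgrow z (hball z hz)
    rw [hfg z hz, norm_mul, norm_exp] at h1
    have h2 := hlow c rfl
    have h3 : ‖z‖ ≤ ‖c‖ + 3 / 2 := by
      have := norm_le_norm_add_norm_sub' z c
      have := mem_ball_iff_norm.mp hz
      linarith
    have h4 : (1 + ‖z‖) ^ 2 ≤ (5 + |s.im|) ^ 2 := by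
      exact pow_le_pow_left₀ (by positivity) (by linarith) 2
    rw [hM, Real.le_log_iff_exp_le (by linarith)]
    nlinarith [Real.exp_pos (g z).re]
  have hgb : ∀ z ∈ sphere s (1 / 20), ‖g z‖ ≤ 58 * M := fun z hz ↦ by
    have h1 : ‖s - c‖ ≤ 7 / 5 := by
      have : s - c = ((s.re - 2 : ℝ) : ℂ) := by apply Complex.ext <;> simp [hc]
      rw [this, norm_real, Real.norm_eq_abs, abs_le]
      constructor <;> linarith
    have h2 : ‖z - c‖ ≤ 29 / 20 := by
      have := mem_sphere_iff_norm.mp hz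
      have := norm_sub_le_norm_sub_add_norm_sub z s c
      linarith
    have h3 := borelCaratheodory_zero (f := fun w ↦ g (c + w)) (R := 3 / 2) (z := z - c) hMpos
      (fun w hw ↦ by
        have hw' : c + w ∈ ball c (3 / 2) := by simpa using hw
        exact (DifferentiableAt.comp w (hg _ hw').differentiableAt
          (by fun_prop)).differentiableWithinAt)
      (fun w hw ↦ hre _ (by simpa using hw)) (by norm_num)
      (by rw [mem_ball_zero_iff]; linarith) (by simpa using hg0)
    simp only [add_sub_cancel] at h3
    refine h3.trans ?_
    rw [div_le_iff₀ (by linarith)]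
    nlinarith
  have hsball : s ∈ ball c (3 / 2) := by
    rw [mem_ball_iff_norm]
    have : s - c = ((s.re - 2 : ℝ) : ℂ) := by apply Complex.ext <;> simp [hc]
    rw [this, norm_real, Real.norm_eq_abs, abs_lt]
    constructor <;> linarith
  rw [← (hg s hsball).deriv]
  have hcl : closedBall s (1 / 20) ⊆ ball c (3 / 2) := fun z hz ↦ by
    rw [mem_ball_iff_norm]
    have h1 := mem_closedBall_iff_norm.mp hz
    have h2 := norm_sub_le_norm_sub_add_norm_sub z s c
    have : s - c = ((s.re - 2 : ℝ) : ℂ) := by apply Complex.ext <;> simp [hc]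
    rw [this, norm_real, Real.norm_eq_abs] at h2
    have : |s.re - 2| ≤ 7 / 5 := abs_le.mpr ⟨by linarith, by linarith⟩
    linarith
  have hdc : DiffContOnCl ℂ g (ball s (1 / 20)) := by
    refine DifferentiableOn.diffContOnCl fun z hz ↦ ?_
    exact (hg z (hcl (closure_ball_subset_closedBall hz))).differentiableAt.differentiableWithinAt
  refine (norm_deriv_le_of_forall_mem_sphere_norm_le (by norm_num) hdc hgb).trans ?_
  linarith

end LogDerivative

section LFunctionGrowth

open Complex Set Filter Asymptotics MeasureTheory

variable {N : ℕ} [NeZero N]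

/-- The partial sums of a Dirichlet character grow linearly, up to a bounded error. -/
theorem DirichletCharacter.exists_norm_sum_sub_mul_le (χ : DirichletCharacter ℂ N) :
    ∃ c : ℂ, ‖c‖ ≤ 1 ∧ (χ ≠ 1 → c = 0) ∧
      ∀ n : ℕ, ‖∑ k ∈ Finset.Icc 1 n, χ k - c * n‖ ≤ 2 * N := by
  have hN : (0 : ℝ) < N := by exact_mod_cast Nat.pos_of_ne_zero (NeZero.ne N)
  have hN' : (N : ℂ) ≠ 0 := by exact_mod_cast NeZero.ne N
  set c : ℂ := (∑ a : ZMod N, χ a) / N with hc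
  have hcn : ‖c‖ ≤ 1 := by
    rw [hc, norm_div, norm_natCast, div_le_one hN]
    refine (norm_sum_le _ _).trans ((Finset.sum_le_card_nsmul _ _ 1
      fun a _ ↦ χ.norm_le_one a).trans ?_)
    simp
  refine ⟨c, hcn, fun h ↦ by rw [hc, MulChar.sum_eq_zero_of_ne_one h, zero_div], fun n ↦ ?_⟩
  set D : ℕ → ℂ := fun n ↦ ∑ k ∈ Finset.range n, (χ (k + 1 : ℕ) - c) with hD
  have hDn : ∀ n : ℕ, ∑ k ∈ Finset.Icc 1 n, χ k - c * n = D n := fun n ↦ by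
    simp only [hD]
    rw [Finset.sum_sub_distrib, Finset.sum_const, Finset.card_range, nsmul_eq_mul, mul_comm,
      Finset.range_eq_Ico, Finset.sum_Ico_add' (fun k : ℕ ↦ χ k) 0 n 1]
    rfl
  have hper : Function.Periodic D N := fun m ↦ by
    induction m with
    | zero =>
      simp only [hD, zero_add, Finset.range_zero, Finset.sum_empty]
      rw [Finset.sum_sub_distrib, Finset.sum_const, Finset.card_range, nsmul_eq_mul, hc,
        mul_div_cancel₀ _ hN', sub_eq_zero, ← Equiv.sum_comp (Equiv.addRight (1 : ZMod N))]
      refine Finset.sum_nbij' (fun k : ℕ ↦ (k : ZMod N)) ZMod.val (by simp)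
        (by simp [ZMod.val_lt]) (fun k hk ↦ ZMod.val_cast_of_lt (by simpa using hk))
        (by simp) (by simp)
    | succ m ih =>
      have : D (m + 1 + N) = D (m + N) + (χ (m + N + 1 : ℕ) - c) := by
        rw [show m + 1 + N = (m + N) + 1 by ring]
        exact Finset.sum_range_succ _ _
      rw [this, ih]
      have h : χ (m + N + 1 : ℕ) = χ (m + 1 : ℕ) := by simp
      rw [h]
      exact (Finset.sum_range_succ (fun k : ℕ ↦ χ (k + 1 : ℕ) - c) m).symm
  rw [hDn, ← hper.map_mod_nat]
  have hlt : n % N ≤ N := (Nat.mod_lt _ (Nat.pos_of_ne_zero (NeZero.ne N))).le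
  refine (norm_sum_le _ _).trans ((Finset.sum_le_card_nsmul _ _ 2 fun k _ ↦ ?_).trans ?_)
  · have h1 := χ.norm_le_one (k + 1 : ℕ)
    exact (norm_sub_le _ _).trans (by linarith)
  · rw [Finset.card_range, nsmul_eq_mul, mul_comm]
    gcongr

/-- The Mellin-type integral of a bounded function supported on `(1, ∞)` is holomorphic and bounded
on right half-planes. -/
theorem differentiableAt_norm_le_integral_Ioi {R : ℝ → ℂ} {B : ℝ}
    (hR : LocallyIntegrableOn R (Ici 1)) (hB : ∀ u, 1 ≤ u → ‖R u‖ ≤ B) {s : ℂ} (hs : 0 < s.re) :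
    DifferentiableAt ℂ (fun s : ℂ ↦ ∫ u in Ioi (1 : ℝ), R u * (u : ℂ) ^ (-(s + 1))) s ∧
      ‖∫ u in Ioi (1 : ℝ), R u * (u : ℂ) ^ (-(s + 1))‖ ≤ B / s.re := by
  constructor
  · set f : ℝ → ℂ := (Ioi 1).indicator R with hf
    have hM : (fun s : ℂ ↦ ∫ u in Ioi (1 : ℝ), R u * (u : ℂ) ^ (-(s + 1))) =
        fun s ↦ mellin f (-s) := by
      ext s
      rw [mellin, ← integral_indicator measurableSet_Ioi, ← integral_indicator measurableSet_Ioi]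
      congr 1
      ext u
      by_cases hu : 1 < u
      · have : (0 : ℝ) < u := by linarith
        simp [hf, hu, this, mul_comm, show -(s + 1) = -s - 1 by ring]
      · simp [hf, indicator, hu]
    rw [hM]
    have hfb : ∀ u, ‖f u‖ ≤ |B| := fun u ↦ by
      by_cases hu : 1 < u
      · simpa [hf, hu] using (hB u hu.le).trans (le_abs_self B)
      · simp [hf, hu]
    refine DifferentiableAt.comp (g := mellin f) (f := fun s ↦ -s) s
      (mellin_differentiableAt_of_isBigO_rpow (a := 0)
      (b := -s.re - 1) ?_ ?_ (by simpa) ?_ (by simp)) (by fun_prop)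
    · have h1 : LocallyIntegrable f := by
        rw [hf]
        intro x
        obtain hx | hx := lt_or_ge x 1
        · refine ⟨Iio 1, Iio_mem_nhds hx, ?_⟩
          refine (integrableOn_zero (s := Iio (1 : ℝ)) (μ := volume) (ε' := ℂ)).congr_fun
            (fun u hu ↦ ?_) measurableSet_Iio
          have : ¬ 1 < u := not_lt.mpr (le_of_lt hu)
          simp [this]
        · obtain ⟨U, hU, hUi⟩ := hR x hx
          rw [mem_nhdsWithin_iff_exists_mem_nhds_inter] at hU
          obtain ⟨V, hV, hVU⟩ := hU
          refine ⟨V, hV, ?_⟩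
          have h2 : IntegrableOn R (V ∩ Ioi 1) :=
            hUi.mono_set fun u hu ↦ hVU ⟨hu.1, mem_Ici.mpr (le_of_lt hu.2)⟩
          rw [IntegrableOn, integrable_indicator_iff measurableSet_Ioi, IntegrableOn,
            Measure.restrict_restrict measurableSet_Ioi, inter_comm]
          exact h2
      exact h1.locallyIntegrableOn _
    · refine IsBigO.of_bound |B| (Eventually.of_forall fun u ↦ ?_)
      simpa using hfb u
    · refine IsBigO.of_bound 1 ?_
      filter_upwards [mem_nhdsWithin_of_mem_nhds (Iio_mem_nhds (zero_lt_one' ℝ))] with u hu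
      have : ¬ 1 < u := not_lt.mpr (le_of_lt hu)
      simp [hf, this]
  · have hint : IntegrableOn (fun u : ℝ ↦ B * u ^ (-(s.re + 1))) (Ioi 1) :=
      (integrableOn_Ioi_rpow_of_lt (by linarith) zero_lt_one).const_mul _
    refine (norm_integral_le_of_norm_le hint ?_).trans ?_
    · refine (ae_restrict_mem measurableSet_Ioi).mono fun u hu ↦ ?_
      have hu0 : (0 : ℝ) < u := lt_trans zero_lt_one hu
      rw [norm_mul, norm_cpow_eq_rpow_re_of_pos hu0]
      simp only [neg_re, add_re, one_re]
      gcongr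
      exact hB u (le_of_lt hu)
    · rw [integral_const_mul, integral_Ioi_rpow_of_lt (by linarith) zero_lt_one]
      simp [div_eq_mul_inv]

end LFunctionGrowth

section RegularizedLFunction

open Complex Set Filter MeasureTheory DirichletCharacter

theorem LSeries_eq_mul_integral_add {N : ℕ} (χ : DirichletCharacter ℂ N) (c : ℂ)
    {s : ℂ} (hs : 1 < s.re) :
    LSeries (χ ·) s = s * (c / (s - 1) + ∫ u in Ioi (1 : ℝ),
      (∑ k ∈ Finset.Icc 1 ⌊u⌋₊, χ k - c * u) * (u : ℂ) ^ (-(s + 1))) := by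
  have hO : (fun n : ℕ ↦ ∑ k ∈ Finset.Icc 1 n, χ k) =O[atTop] fun n : ℕ ↦ (n : ℝ) ^ (1 : ℝ) := by
    refine Asymptotics.IsBigO.of_bound 1 (Eventually.of_forall fun n ↦ ?_)
    refine (norm_sum_le _ _).trans ((Finset.sum_le_card_nsmul _ _ 1
      fun a _ ↦ χ.norm_le_one ((a : ℕ) : ZMod N)).trans ?_)
    simp
  have hS : LSeriesSummable (χ ·) s := LSeriesSummable_of_one_lt_re χ hs
  have hmain := LSeries_eq_mul_integral (χ ·) zero_le_one hs hS hO
  rw [hmain]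
  congr 1
  have hint1 : IntegrableOn (fun u : ℝ ↦ c * (u : ℂ) ^ (-s)) (Ioi 1) :=
    (integrableOn_Ioi_cpow_of_lt (by simpa using hs) zero_lt_one).const_mul c
  have hloc : LocallyIntegrableOn (fun u : ℝ ↦ (u : ℂ) ^ (-(s + 1)) *
      ∑ k ∈ Finset.Icc 1 ⌊u⌋₊, χ k) (Ici 1) := by
    refine locallyIntegrableOn_mul_sum_Icc _ zero_le_one ?_
    refine ContinuousOn.locallyIntegrableOn (fun t ht ↦ ?_) measurableSet_Ici
    exact (continuousAt_ofReal_cpow_const _ _ <|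
      Or.inr (zero_lt_one.trans_le ht).ne').continuousWithinAt
  have hint2 : IntegrableOn (fun u : ℝ ↦ (∑ k ∈ Finset.Icc 1 ⌊u⌋₊, χ k) *
      (u : ℂ) ^ (-(s + 1))) (Ioi 1) := by
    have hbd : IntegrableOn (fun u : ℝ ↦ u ^ (-s.re)) (Ioi 1) :=
      integrableOn_Ioi_rpow_of_lt (by linarith) zero_lt_one
    refine Integrable.mono' hbd ?_ ?_
    · have := (hloc.mono_set (Ioi_subset_Ici_self)).aestronglyMeasurable
      simpa only [mul_comm] using this
    · refine (ae_restrict_mem measurableSet_Ioi).mono fun u hu ↦ ?_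
      have hu0 : (0 : ℝ) < u := lt_trans zero_lt_one hu
      have h1 : ‖∑ k ∈ Finset.Icc 1 ⌊u⌋₊, χ k‖ ≤ u := by
        refine (norm_sum_le _ _).trans ((Finset.sum_le_card_nsmul _ _ 1
          fun a _ ↦ χ.norm_le_one ((a : ℕ) : ZMod N)).trans ?_)
        simpa using Nat.floor_le hu0.le
      rw [norm_mul, norm_cpow_eq_rpow_re_of_pos hu0]
      calc _ ≤ u * u ^ (-(s + 1)).re := by gcongr
        _ = u ^ (-s.re) := by
          rw [← Real.rpow_one_add' hu0.le (by simp; linarith)]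
          simp
  have h3 : c / (s - 1) = ∫ u in Ioi (1 : ℝ), c * (u : ℂ) ^ (-s) := by
    rw [integral_const_mul, integral_Ioi_cpow_of_lt (by simpa using hs) zero_lt_one]
    have : s - 1 ≠ 0 := fun h ↦ by rw [sub_eq_zero.mp h] at hs; simp at hs
    have h' : -s + 1 ≠ 0 := fun h ↦ this (by linear_combination -h)
    simp only [ofReal_one, one_cpow]
    field_simp
    ring
  have h4 : ∀ u ∈ Ioi (1 : ℝ), (∑ k ∈ Finset.Icc 1 ⌊u⌋₊, χ k - c * u) * (u : ℂ) ^ (-(s + 1)) =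
      (∑ k ∈ Finset.Icc 1 ⌊u⌋₊, χ k) * (u : ℂ) ^ (-(s + 1)) - c * (u : ℂ) ^ (-s) := fun u hu ↦ by
    have hu0 : (u : ℂ) ≠ 0 := by exact_mod_cast (lt_trans zero_lt_one hu).ne'
    rw [sub_mul, mul_assoc c]
    congr 2
    rw [show -s = 1 + -(s + 1) by ring, cpow_add _ _ hu0, cpow_one]
  rw [setIntegral_congr_fun measurableSet_Ioi h4, integral_sub hint2 hint1, ← h3]
  ring

variable {N : ℕ} [NeZero N]

open Classical in
/-- The order of the pole of `L(s, χ)` at `s = 1`. -/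
noncomputable def poleOrder (χ : DirichletCharacter ℂ N) : ℕ := if χ = 1 then 1 else 0

open Classical in
/-- `(s - 1) ^ δ * L(s, χ)`, where `δ` is the order of the pole at `s = 1`. -/
noncomputable def regularizedL (χ : DirichletCharacter ℂ N) : ℂ → ℂ :=
  if χ = 1 then LFunctionTrivChar₁ N else LFunction χ

theorem differentiable_regularizedL (χ : DirichletCharacter ℂ N) :
    Differentiable ℂ (regularizedL χ) := by
  unfold regularizedL
  split_ifs with h
  · exact differentiable_LFunctionTrivChar₁ N
  · exact differentiable_LFunction h

theorem regularizedL_of_ne_one (χ : DirichletCharacter ℂ N) {s : ℂ} (hs : s ≠ 1) :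
    regularizedL χ s = (s - 1) ^ poleOrder χ * LFunction χ s := by
  unfold regularizedL poleOrder
  split_ifs with h
  · subst h
    simp [LFunctionTrivChar₁, hs, LFunctionTrivChar]
  · simp

theorem regularizedL_ne_zero {χ : DirichletCharacter ℂ N}
    (hχ : ∀ s : ℂ, LFunction χ s = 0 → 0 < s.re → s.re < 1 → s.re = 1 / 2)
    {s : ℂ} (hs : 1 / 2 < s.re) : regularizedL χ s ≠ 0 := by
  rcases eq_or_ne s 1 with rfl | h1
  · unfold regularizedL
    split_ifs with h
    · exact LFunctionTrivChar₁_apply_one_ne_zero N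
    · exact LFunction_apply_one_ne_zero h
  · rw [regularizedL_of_ne_one χ h1]
    refine mul_ne_zero (pow_ne_zero _ (sub_ne_zero.mpr h1)) fun h0 ↦ ?_
    rcases lt_or_ge s.re 1 with h | h
    · have := hχ s h0 (by linarith) h
      linarith
    · exact LFunction_ne_zero_of_one_le_re χ (.inr h1) h h0

theorem regularizedL_logDeriv (χ : DirichletCharacter ℂ N) {s : ℂ} (hs : 1 < s.re) :
    -(deriv (regularizedL χ) s / regularizedL χ s) =
      LSeries (fun n ↦ χ n * ArithmeticFunction.vonMangoldt n) s - poleOrder χ / (s - 1) := by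
  have h1 : s ≠ 1 := fun h ↦ by simp [h] at hs
  have hL : LFunction χ s ≠ 0 := LFunction_ne_zero_of_one_le_re χ (.inr h1) hs.le
  have heq : regularizedL χ =ᶠ[nhds s] fun z ↦ (z - 1) ^ poleOrder χ * LFunction χ z := by
    filter_upwards [isOpen_ne.mem_nhds h1] with z hz using regularizedL_of_ne_one χ hz
  have hΛ := LSeries_twist_vonMangoldt_eq χ hs
  rw [← LFunction_eq_LSeries χ hs, ← deriv_LFunction_eq_deriv_LSeries χ hs] at hΛ
  have hΛ' : LSeries (fun n ↦ χ n * ArithmeticFunction.vonMangoldt n) s =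
      -deriv (LFunction χ) s / LFunction χ s := hΛ
  have hLd := (differentiableAt_LFunction χ s (.inl h1)).hasDerivAt
  have hs1 : s - 1 ≠ 0 := sub_ne_zero.mpr h1
  rw [heq.deriv_eq, heq.eq_of_nhds, hΛ']
  unfold poleOrder
  split_ifs with h
  · have : HasDerivAt (fun z : ℂ ↦ (z - 1) ^ 1 * LFunction χ z)
        (1 * LFunction χ s + (s - 1) * deriv (LFunction χ) s) s := by
      simp only [pow_one]
      exact ((hasDerivAt_id s).sub_const 1).mul hLd
    rw [this.deriv]
    field_simp
    simp
    ring
  · simp [neg_div]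

theorem norm_regularizedL_le (χ : DirichletCharacter ℂ N) {s : ℂ} (hs : 1 / 2 < s.re) :
    ‖regularizedL χ s‖ ≤ (10 * N) * (1 + ‖s‖) ^ 2 := by
  obtain ⟨c, hc1, hc0, hc⟩ := χ.exists_norm_sum_sub_mul_le
  have hN : (1 : ℝ) ≤ N := by exact_mod_cast Nat.one_le_iff_ne_zero.mpr (NeZero.ne N)
  set R : ℝ → ℂ := fun u ↦ ∑ k ∈ Finset.Icc 1 ⌊u⌋₊, χ k - c * u with hR
  have hRloc : LocallyIntegrableOn R (Ici 1) := by
    have h1 : LocallyIntegrableOn (fun u : ℝ ↦ (1 : ℂ) * ∑ k ∈ Finset.Icc 1 ⌊u⌋₊, χ k) (Ici 1) :=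
      locallyIntegrableOn_mul_sum_Icc _ zero_le_one
        ((continuous_const.locallyIntegrable).locallyIntegrableOn _)
    simp only [one_mul] at h1
    exact h1.sub (Continuous.locallyIntegrable (by fun_prop) |>.locallyIntegrableOn _)
  have hRb : ∀ u, 1 ≤ u → ‖R u‖ ≤ 3 * N := fun u hu ↦ by
    have h1 := hc ⌊u⌋₊
    have h2 : ‖c * (⌊u⌋₊ : ℂ) - c * u‖ ≤ 1 := by
      rw [← mul_sub, norm_mul]
      have : ‖((⌊u⌋₊ : ℂ) - u)‖ ≤ 1 := by
        rw [show ((⌊u⌋₊ : ℂ) - u) = ((⌊u⌋₊ - u : ℝ) : ℂ) by push_cast; rfl, norm_real,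
          Real.norm_eq_abs, abs_le]
        have := Nat.floor_le (zero_le_one.trans hu)
        have := Nat.lt_floor_add_one u
        constructor <;> linarith
      nlinarith [norm_nonneg c]
    calc ‖R u‖ = ‖(∑ k ∈ Finset.Icc 1 ⌊u⌋₊, χ k - c * ⌊u⌋₊) + (c * (⌊u⌋₊ : ℂ) - c * u)‖ := by
          congr 1; simp only [hR]; ring
      _ ≤ 2 * N + 1 := (norm_add_le _ _).trans (add_le_add h1 h2)
      _ ≤ 3 * N := by linarith
  set M : ℂ → ℂ := fun s ↦ ∫ u in Ioi (1 : ℝ), R u * (u : ℂ) ^ (-(s + 1)) with hM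
  have hMd := fun {s : ℂ} (hs : 0 < s.re) ↦ differentiableAt_norm_le_integral_Ioi hRloc hRb hs
  have hEq : EqOn (regularizedL χ) (fun s ↦ s * (c + (s - 1) ^ poleOrder χ * M s))
      {s : ℂ | 0 < s.re} := by
    have ho : IsOpen {s : ℂ | 0 < s.re} := isOpen_lt continuous_const continuous_re
    refine AnalyticOnNhd.eqOn_of_preconnected_of_eventuallyEq (z₀ := 2)
      ((differentiable_regularizedL χ).differentiableOn.analyticOnNhd ho)
      (DifferentiableOn.analyticOnNhd (fun s hs ↦ ?_) ho)
      (convex_halfSpace_re_gt 0).isPreconnected (by simp) ?_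
    · have := (hMd hs).1
      exact DifferentiableAt.differentiableWithinAt (by fun_prop)
    · have ho1 : IsOpen {s : ℂ | 1 < s.re} := isOpen_lt continuous_const continuous_re
      filter_upwards [ho1.mem_nhds (show (2 : ℂ) ∈ {s : ℂ | 1 < s.re} by simp)] with s hs
      have h1 : s ≠ 1 := fun h ↦ by simp [h] at hs
      have hs1 : s - 1 ≠ 0 := sub_ne_zero.mpr h1
      rw [regularizedL_of_ne_one χ h1, LFunction_eq_LSeries χ hs,
        LSeries_eq_mul_integral_add χ c hs]
      unfold poleOrder
      split_ifs with h
      · simp only [pow_one]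
        field_simp
        rfl
      · simp [hc0 h, hM, hR]
  have hMs := (hMd (show 0 < s.re by linarith)).2
  have hM6 : ‖M s‖ ≤ 6 * N := hMs.trans (by rw [div_le_iff₀ (by linarith)]; nlinarith)
  rw [hEq (show 0 < s.re by linarith)]
  have hsn := norm_nonneg s
  have hpow : ‖(s - 1) ^ poleOrder χ‖ ≤ 1 + ‖s‖ := by
    unfold poleOrder
    split_ifs with h
    · rw [pow_one]
      exact (norm_sub_le _ _).trans (by simp [add_comm])
    · simp
  calc ‖s * (c + (s - 1) ^ poleOrder χ * M s)‖
      ≤ ‖s‖ * (‖c‖ + ‖(s - 1) ^ poleOrder χ‖ * ‖M s‖) := by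
        rw [norm_mul, ← norm_mul _ (M s)]
        gcongr
        exact norm_add_le _ _
    _ ≤ (1 + ‖s‖) * (1 + (1 + ‖s‖) * (6 * N)) := by
        gcongr
        linarith
    _ ≤ (10 * N) * (1 + ‖s‖) ^ 2 := by nlinarith [mul_nonneg hsn (by linarith : (0 : ℝ) ≤ N)]

theorem quarter_le_norm_regularizedL (χ : DirichletCharacter ℂ N) {s : ℂ} (hs : s.re = 2) :
    1 / 4 ≤ ‖regularizedL χ s‖ := by
  have hs1 : 1 < s.re := by rw [hs]; norm_num
  have h1 : s ≠ 1 := fun h ↦ by simp [h] at hs1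
  rw [regularizedL_of_ne_one χ h1, norm_mul]
  have hpow : 1 ≤ ‖(s - 1) ^ poleOrder χ‖ := by
    rw [norm_pow]
    refine one_le_pow₀ ?_
    refine le_trans ?_ (abs_re_le_norm (s - 1))
    simp [hs]
    norm_num
  have hL : 1 / 4 ≤ ‖LFunction χ s‖ := by
    rw [LFunction_eq_LSeries χ hs1]
    have hS : Summable (LSeries.term (χ ·) s) := LSeriesSummable_of_one_lt_re χ hs1
    have hsum : Summable (fun n : ℕ ↦ 1 / (n : ℝ) ^ 2) :=
      Real.summable_one_div_nat_pow.mpr one_lt_two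
    have hb : ∀ n : ℕ, ‖LSeries.term (χ ·) s n‖ ≤ 1 / (n : ℝ) ^ 2 := fun n ↦ by
      rw [LSeries.norm_term_eq, hs]
      split_ifs with h
      · positivity
      · norm_cast
        gcongr
        exact χ.norm_le_one n
    have h2 := hS.sum_add_tsum_nat_add 2
    have h3 := hsum.sum_add_tsum_nat_add 2
    rw [hasSum_zeta_two.tsum_eq] at h3
    simp only [Finset.sum_range_succ, Finset.sum_range_zero] at h2 h3
    have h4 : ‖∑' i, LSeries.term (χ ·) s (i + 2)‖ ≤ ∑' i : ℕ, 1 / ((i + 2 : ℕ) : ℝ) ^ 2 :=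
      tsum_of_norm_bounded ((summable_nat_add_iff 2).mpr hsum).hasSum fun i ↦ hb _
    have h5 : LSeries.term (χ ·) s 0 = 0 := LSeries.term_zero _ _
    have h6 : LSeries.term (χ ·) s 1 = 1 := by simp [LSeries.term]
    rw [h5, h6] at h2
    norm_num at h3
    have hpi : Real.pi ^ 2 / 6 < 7 / 4 := by
      have := Real.pi_lt_d2
      nlinarith [Real.pi_pos]
    have h7 : LSeries (χ ·) s = 0 + 0 + 1 + ∑' i, LSeries.term (χ ·) s (i + 2) := h2.symm
    rw [h7, zero_add, zero_add]
    have h8 := norm_sub_le_norm_add (1 : ℂ) (∑' i, LSeries.term (χ ·) s (i + 2))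
    have h9 : ∑' i : ℕ, 1 / ((i + 2 : ℕ) : ℝ) ^ 2 = Real.pi ^ 2 / 6 - 1 := by
      rw [← h3]
      push_cast
      simp
    rw [h9] at h4
    rw [norm_one] at h8
    linarith
  nlinarith [norm_nonneg (LFunction χ s)]

/-- Under the Riemann hypothesis for `L(s, χ)`, its regularized logarithmic derivative grows at most
like `log N` times a small power of `1 + |Im s|` in `3/5 ≤ Re s ≤ 2`. -/
theorem exists_norm_logDeriv_regularizedL_le : ∃ K : ℝ, 0 < K ∧
    ∀ (N : ℕ) [NeZero N] (χ : DirichletCharacter ℂ N), 3 ≤ N →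
      (∀ s : ℂ, LFunction χ s = 0 → 0 < s.re → s.re < 1 → s.re = 1 / 2) →
      ∀ s : ℂ, 3 / 5 ≤ s.re → s.re ≤ 2 →
        ‖deriv (regularizedL χ) s / regularizedL χ s‖ ≤
          K * Real.log N * (1 + |s.im|) ^ (1 / 20 : ℝ) := by
  refine ⟨1160 * (Real.log 40 + 1 + 2 * Real.log 5 + 40), ?_, fun N _ χ hN hχ s hs hs2 ↦ ?_⟩
  · have := Real.log_nonneg (show (1 : ℝ) ≤ 40 by norm_num)
    have := Real.log_nonneg (show (1 : ℝ) ≤ 5 by norm_num)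
    positivity
  · have hN3 : (3 : ℝ) ≤ N := by exact_mod_cast hN
    have h := norm_logDeriv_le_of_growth (differentiable_regularizedL χ)
      (fun s ↦ regularizedL_ne_zero hχ) (A := 10 * N) (by linarith)
      (fun s ↦ norm_regularizedL_le χ) (fun s ↦ quarter_le_norm_regularizedL χ) hs hs2
    refine h.trans ?_
    rw [mul_assoc 1160, mul_assoc 1160]
    gcongr
    have ha := abs_nonneg s.im
    set a := |s.im|
    have hlogN : 1 ≤ Real.log N := by
      rw [Real.le_log_iff_exp_le (by linarith)]
      exact Real.exp_one_lt_d9.le.trans (by linarith)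
    have hp : 1 ≤ (1 + a) ^ (1 / 20 : ℝ) := Real.one_le_rpow (by linarith) (by norm_num)
    have h40 := Real.log_nonneg (show (1 : ℝ) ≤ 40 by norm_num)
    have h5 := Real.log_nonneg (show (1 : ℝ) ≤ 5 by norm_num)
    have hl : Real.log (1 + a) ≤ 20 * (1 + a) ^ (1 / 20 : ℝ) := by
      have := Real.log_le_rpow_div (show 0 ≤ 1 + a by linarith) (show (0 : ℝ) < 1 / 20 by norm_num)
      linarith
    have hle : Real.log (5 + a) ≤ Real.log 5 + Real.log (1 + a) := by
      rw [← Real.log_mul (by norm_num) (by linarith)]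
      exact Real.log_le_log (by linarith) (by linarith)
    have heq : Real.log (4 * (10 * N) * (5 + a) ^ 2) =
        Real.log 40 + Real.log N + 2 * Real.log (5 + a) := by
      rw [Real.log_mul (by positivity) (by positivity), Real.log_pow,
        show (4 * (10 * N) : ℝ) = 40 * N by ring, Real.log_mul (by norm_num) (by positivity)]
      simp
    rw [heq]
    set l := Real.log N
    set P := (1 + a) ^ (1 / 20 : ℝ)
    have hlP : 1 ≤ l * P := by nlinarith
    have h1 : l ≤ l * P := by nlinarith
    have h2 : P ≤ l * P := by nlinarith
    nlinarith

end RegularizedLFunction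

section PerronKernel

open Complex Set Filter MeasureTheory

theorem one_add_sq_le_norm_mul_norm {σ : ℝ} (hσ : 1 ≤ σ) (t : ℝ) :
    1 + t ^ 2 ≤ ‖(σ + t * I : ℂ)‖ * ‖(σ + t * I + 1 : ℂ)‖ := by
  have h1 : ‖(σ + t * I : ℂ)‖ ^ 2 = σ ^ 2 + t ^ 2 := by
    rw [← normSq_eq_norm_sq, normSq_add_mul_I]
  have h2 : ‖(σ + t * I + 1 : ℂ)‖ ^ 2 = (σ + 1) ^ 2 + t ^ 2 := by
    rw [← normSq_eq_norm_sq, ← normSq_add_mul_I]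
    congr 1
    push_cast
    ring
  refine abs_le_of_sq_le_sq' ?_ (by positivity) |>.2
  rw [mul_pow, h1, h2]
  nlinarith [sq_nonneg t, sq_nonneg σ, sq_nonneg (t ^ 2)]

theorem mellinInv_max_one_sub {x : ℝ} (hx : 0 < x) :
    ∫ t : ℝ, (x : ℂ) ^ (-((2 : ℝ) + t * I : ℂ)) *
      (1 / (((2 : ℝ) + t * I : ℂ) * ((2 : ℝ) + t * I + 1))) =
      2 * Real.pi * (max (1 - x) 0 : ℝ) := by
  set f : ℝ → ℂ := fun t ↦ indicator (Ioc 0 1) (fun t ↦ t ^ (0 : ℂ) : ℝ → ℂ) t -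
    indicator (Ioc 0 1) (fun t ↦ t ^ (1 : ℂ) : ℝ → ℂ) t with hf
  have hM : ∀ s : ℂ, 1 < s.re → HasMellin f s (1 / (s * (s + 1))) := fun s hs ↦ by
    have h0 := hasMellin_cpow_Ioc 0 (s := s) (by simp; linarith)
    have h1 := hasMellin_cpow_Ioc 1 (s := s) (by simp; linarith)
    have h := hasMellin_sub h0.1 h1.1
    rw [h0.2, h1.2] at h
    have hs0 : s ≠ 0 := fun h ↦ by simp [h] at hs; linarith
    have hs1 : s + 1 ≠ 0 := fun h ↦ by
      rw [eq_neg_of_add_eq_zero_left h] at hs; simp at hs; linarith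
    have he : 1 / (s + 0) - 1 / (s + 1) = 1 / (s * (s + 1)) := by
      rw [add_zero]
      field_simp
      ring
    rw [he] at h
    exact h
  have hfx : ∀ t : ℝ, 0 < t → f t = (max (1 - t) 0 : ℝ) := fun t ht ↦ by
    simp only [hf, indicator, mem_Ioc, ht, true_and, cpow_zero, cpow_one]
    split_ifs with h
    · rw [max_eq_left (by linarith)]; push_cast; ring
    · rw [max_eq_right (by linarith)]; simp
  have hcont : ContinuousAt f x := by
    have : ContinuousAt (fun t : ℝ ↦ ((max (1 - t) 0 : ℝ) : ℂ)) x := by fun_prop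
    exact this.congr ((lt_mem_nhds hx).mono fun t ht ↦ (hfx t ht).symm)
  have hre : ∀ t : ℝ, 1 < ((2 : ℝ) + t * I : ℂ).re := fun t ↦ by simp
  have hvert : VerticalIntegrable (mellin f) 2 := by
    refine (integrable_inv_one_add_sq.mono' ?_ (.of_forall fun t ↦ ?_) :
      Integrable fun t : ℝ ↦ mellin f ((2 : ℝ) + t * I))
    · simp_rw [fun t ↦ (hM _ (hre t)).2]
      exact (by fun_prop : Measurable _).aestronglyMeasurable
    · rw [(hM _ (hre t)).2, norm_div, norm_mul, norm_one, one_div]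
      exact inv_anti₀ (by positivity) (one_add_sq_le_norm_mul_norm one_le_two t)
  have h := mellinInv_mellin_eq 2 f hx (hM _ (by simp)).1 hvert hcont
  rw [hfx x hx, mellinInv] at h
  simp_rw [fun t ↦ (hM _ (hre t)).2, smul_eq_mul] at h
  have hpi : (2 * Real.pi : ℂ) * ((1 / (2 * Real.pi) : ℝ) : ℂ) = 1 := by
    have : (Real.pi : ℂ) ≠ 0 := by exact_mod_cast Real.pi_ne_zero
    push_cast
    field_simp
  rw [← h, real_smul, ← mul_assoc, hpi, one_mul]

theorem mellinInv_max_one_sub_sq_div {x : ℝ} (hx : 0 < x) :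
    ∫ t : ℝ, (x : ℂ) ^ (-((2 : ℝ) + t * I : ℂ)) * (1 / ((2 : ℝ) + t * I - 1) *
      (1 / (((2 : ℝ) + t * I : ℂ) * ((2 : ℝ) + t * I + 1)))) =
      2 * Real.pi * (max (1 - x) 0 ^ 2 / (2 * x) : ℝ) := by
  set f : ℝ → ℂ := fun t ↦ ((2⁻¹ : ℂ) • indicator (Ioc 0 1) (fun t ↦ t ^ (-1 : ℂ) : ℝ → ℂ) t -
    indicator (Ioc 0 1) (fun t ↦ t ^ (0 : ℂ) : ℝ → ℂ) t) +
    (2⁻¹ : ℂ) • indicator (Ioc 0 1) (fun t ↦ t ^ (1 : ℂ) : ℝ → ℂ) t with hf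
  have hM : ∀ s : ℂ, 1 < s.re → HasMellin f s (1 / (s - 1) * (1 / (s * (s + 1)))) := fun s hs ↦ by
    have h0 := hasMellin_cpow_Ioc 0 (s := s) (by simp; linarith)
    have h1 := hasMellin_cpow_Ioc 1 (s := s) (by simp; linarith)
    have h2 := hasMellin_cpow_Ioc (-1) (s := s) (by simp; linarith)
    have h1' := hasMellin_const_smul h1.1 (2⁻¹ : ℂ)
    have h2' := hasMellin_const_smul h2.1 (2⁻¹ : ℂ)
    have h3 := hasMellin_sub h2'.1 h0.1
    have h := hasMellin_add h3.1 h1'.1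
    rw [h1'.2, h3.2, h2'.2, h0.2, h1.2, h2.2] at h
    have hs0 : s ≠ 0 := fun h ↦ by simp [h] at hs; linarith
    have hs1 : s + 1 ≠ 0 := fun h ↦ by
      rw [eq_neg_of_add_eq_zero_left h] at hs; simp at hs; linarith
    have hs2 : s - 1 ≠ 0 := fun h ↦ by
      rw [sub_eq_zero.mp h] at hs; simp at hs
    have he : (2⁻¹ : ℂ) • (1 / (s + -1)) - 1 / (s + 0) + (2⁻¹ : ℂ) • (1 / (s + 1)) =
        1 / (s - 1) * (1 / (s * (s + 1))) := by
      rw [add_zero, ← sub_eq_add_neg, smul_eq_mul, smul_eq_mul]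
      field_simp
      ring
    rw [he] at h
    exact h
  have hfx : ∀ t : ℝ, 0 < t → f t = (max (1 - t) 0 ^ 2 / (2 * t) : ℝ) := fun t ht ↦ by
    have ht0 : (t : ℂ) ≠ 0 := by exact_mod_cast ht.ne'
    simp only [hf, indicator, mem_Ioc, ht, true_and, cpow_zero, cpow_one, cpow_neg_one]
    split_ifs with h
    · rw [max_eq_left (by linarith)]; push_cast; simp only [smul_eq_mul]; field_simp; ring
    · rw [max_eq_right (by linarith)]; simp
  have hcont : ContinuousAt f x := by
    have : ContinuousAt (fun t : ℝ ↦ ((max (1 - t) 0 ^ 2 / (2 * t) : ℝ) : ℂ)) x := by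
      refine continuous_ofReal.continuousAt.comp (ContinuousAt.div (by fun_prop) (by fun_prop) ?_)
      positivity
    exact this.congr ((lt_mem_nhds hx).mono fun t ht ↦ (hfx t ht).symm)
  have hre : ∀ t : ℝ, 1 < ((2 : ℝ) + t * I : ℂ).re := fun t ↦ by simp
  have hvert : VerticalIntegrable (mellin f) 2 := by
    refine (integrable_inv_one_add_sq.mono' ?_ (.of_forall fun t ↦ ?_) :
      Integrable fun t : ℝ ↦ mellin f ((2 : ℝ) + t * I))
    · simp_rw [fun t ↦ (hM _ (hre t)).2]
      exact (by fun_prop : Measurable _).aestronglyMeasurable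
    · have h1 : 1 ≤ ‖((2 : ℝ) + t * I - 1 : ℂ)‖ := by
        refine le_trans ?_ (abs_re_le_norm _)
        simp
        norm_num
      rw [(hM _ (hre t)).2, norm_mul, norm_div, norm_div, norm_mul, norm_one, one_div, one_div]
      calc _ ≤ 1 * (1 + t ^ 2)⁻¹ := by
            gcongr
            · exact inv_le_one_of_one_le₀ h1
            · exact one_add_sq_le_norm_mul_norm one_le_two t
        _ = _ := one_mul _
  have h := mellinInv_mellin_eq 2 f hx (hM _ (by simp)).1 hvert hcont
  rw [hfx x hx, mellinInv] at h
  simp_rw [fun t ↦ (hM _ (hre t)).2, smul_eq_mul] at h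
  have hpi : (2 * Real.pi : ℂ) * ((1 / (2 * Real.pi) : ℝ) : ℂ) = 1 := by
    have : (Real.pi : ℂ) ≠ 0 := by exact_mod_cast Real.pi_ne_zero
    push_cast
    field_simp
  rw [← h, real_smul, ← mul_assoc, hpi, one_mul]

end PerronKernel

section PerronFormula

open Complex Set Filter MeasureTheory DirichletCharacter

theorem integrable_one_div_mul_add_one :
    Integrable fun t : ℝ ↦ (1 / (((2 : ℝ) + t * I : ℂ) * ((2 : ℝ) + t * I + 1))) := by
  refine integrable_inv_one_add_sq.mono' (by fun_prop : Measurable _).aestronglyMeasurable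
    (.of_forall fun t ↦ ?_)
  rw [norm_div, norm_mul, norm_one, one_div]
  exact inv_anti₀ (by positivity) (one_add_sq_le_norm_mul_norm one_le_two t)

theorem integrable_cpow_mul_one_div {y : ℝ} (hy : 0 < y) :
    Integrable fun t : ℝ ↦ (y : ℂ) ^ ((2 : ℝ) + t * I : ℂ) *
      (1 / (((2 : ℝ) + t * I : ℂ) * ((2 : ℝ) + t * I + 1))) := by
  refine integrable_one_div_mul_add_one.bdd_mul (c := y ^ (2 : ℝ)) ?_ (.of_forall fun t ↦ ?_)
  · refine Continuous.aestronglyMeasurable (Continuous.const_cpow (by fun_prop) (.inl ?_))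
    exact_mod_cast hy.ne'
  · rw [norm_cpow_eq_rpow_re_of_pos hy]
    simp

theorem one_le_norm_sub_one (t : ℝ) : 1 ≤ ‖((2 : ℝ) + t * I - 1 : ℂ)‖ := by
  refine le_trans ?_ (abs_re_le_norm _)
  simp
  norm_num

theorem hasSum_integral_LSeries_term {N : ℕ} (χ : DirichletCharacter ℂ N) {y : ℝ} (hy : 0 < y) :
    HasSum (fun n : ℕ ↦ 2 * Real.pi * (χ n * ArithmeticFunction.vonMangoldt n *
        (max (1 - n / y) 0 : ℝ) : ℂ))
      (∫ t : ℝ, LSeries (fun n ↦ χ n * ArithmeticFunction.vonMangoldt n) ((2 : ℝ) + t * I) *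
        ((y : ℂ) ^ ((2 : ℝ) + t * I : ℂ) *
          (1 / (((2 : ℝ) + t * I : ℂ) * ((2 : ℝ) + t * I + 1))))) := by
  set a : ℕ → ℂ := fun n ↦ χ n * ArithmeticFunction.vonMangoldt n with ha
  set k : ℝ → ℂ := fun t ↦ 1 / (((2 : ℝ) + t * I : ℂ) * ((2 : ℝ) + t * I + 1)) with hk
  have hkint : Integrable k := integrable_one_div_mul_add_one
  set F : ℕ → ℝ → ℂ := fun n t ↦ a n * (((n / y : ℝ) : ℂ) ^ (-((2 : ℝ) + t * I : ℂ)) * k t) with hF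
  have ha0 : a 0 = 0 := by simp [ha]
  have hnorm : ∀ n t, ‖F n t‖ = ‖LSeries.term a 2 n‖ * y ^ 2 * ‖k t‖ := fun n t ↦ by
    rcases eq_or_ne n 0 with rfl | hn
    · simp [hF, ha0]
    · have hn0 : (0 : ℝ) < n := by positivity
      have h2 : -(((2 : ℝ) + t * I : ℂ)).re = -((2 : ℕ) : ℝ) := by simp
      simp only [hF]
      rw [norm_mul (a n), norm_mul _ (k t), norm_cpow_eq_rpow_re_of_pos (by positivity), neg_re, h2,
        Real.rpow_neg (by positivity), Real.rpow_natCast, LSeries.norm_term_eq, if_neg hn]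
      norm_num
      field_simp
  have hterm : ∀ n t, F n t = LSeries.term a ((2 : ℝ) + t * I) n *
      ((y : ℂ) ^ ((2 : ℝ) + t * I : ℂ) * k t) := fun n t ↦ by
    rcases eq_or_ne n 0 with rfl | hn
    · simp [hF, ha0]
    · have hn0 : (0 : ℝ) < n := by positivity
      simp only [hF]
      rw [LSeries.term_of_ne_zero hn, cpow_neg, ofReal_div, div_cpow_ofReal_nonneg hn0.le hy.le,
        ofReal_natCast, inv_div]
      ring
  have hmeas : ∀ n, Integrable (F n) := fun n ↦ by
    refine (hkint.norm.const_mul (‖LSeries.term a 2 n‖ * y ^ 2)).mono' ?_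
      (.of_forall fun t ↦ (hnorm n t).le)
    rcases eq_or_ne n 0 with rfl | hn
    · simp only [hF, ha0, zero_mul]
      exact aestronglyMeasurable_const
    · refine AEStronglyMeasurable.const_mul (AEStronglyMeasurable.mul ?_ hkint.1) _
      refine Continuous.aestronglyMeasurable (Continuous.const_cpow (by fun_prop) (.inl ?_))
      have : (n / y : ℝ) ≠ 0 := by positivity
      exact_mod_cast this
  have hsumm : Summable fun n ↦ ∫ t, ‖F n t‖ := by
    simp_rw [hnorm, integral_const_mul]
    refine Summable.mul_right _ (Summable.mul_right _ (Summable.norm ?_))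
    exact χ.LSeriesSummable_twist_vonMangoldt (s := 2) (by simp)
  have hmain := hasSum_integral_of_summable_integral_norm hmeas hsumm
  have h1 : ∀ n : ℕ, ∫ t, F n t =
      2 * Real.pi * (χ n * ArithmeticFunction.vonMangoldt n * (max (1 - n / y) 0 : ℝ) : ℂ) :=
    fun n ↦ by
    simp only [hF]
    rw [integral_const_mul]
    rcases eq_or_ne n 0 with rfl | hn
    · simp [ha0]
    · rw [mellinInv_max_one_sub (by positivity)]
      simp only [ha]
      ring
  have h2 : ∀ t, ∑' n, F n t = LSeries a ((2 : ℝ) + t * I) *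
      ((y : ℂ) ^ ((2 : ℝ) + t * I : ℂ) * k t) := fun t ↦ by
    simp_rw [fun n ↦ hterm n t]
    rw [tsum_mul_right]
    rfl
  simp_rw [h1, h2] at hmain
  exact hmain

variable {N : ℕ} [NeZero N]

theorem continuous_logDeriv_regularizedL (χ : DirichletCharacter ℂ N) :
    Continuous fun t : ℝ ↦
      deriv (regularizedL χ) ((2 : ℝ) + t * I) / regularizedL χ ((2 : ℝ) + t * I) := by
  refine Continuous.div ?_ ?_ fun t h0 ↦ ?_
  · exact (differentiable_regularizedL χ).deriv.continuous.comp (by fun_prop)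
  · exact (differentiable_regularizedL χ).continuous.comp (by fun_prop)
  · have := quarter_le_norm_regularizedL χ (s := (2 : ℝ) + t * I) (by simp)
    rw [h0, norm_zero] at this
    linarith

theorem integrable_logDeriv_regularizedL (χ : DirichletCharacter ℂ N) {y : ℝ} (hy : 0 < y) :
    Integrable fun t : ℝ ↦
      -(deriv (regularizedL χ) ((2 : ℝ) + t * I) / regularizedL χ ((2 : ℝ) + t * I)) *
        ((y : ℂ) ^ ((2 : ℝ) + t * I : ℂ) *
          (1 / (((2 : ℝ) + t * I : ℂ) * ((2 : ℝ) + t * I + 1)))) := by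
  have hk := integrable_cpow_mul_one_div hy
  set a : ℕ → ℂ := fun n ↦ χ n * ArithmeticFunction.vonMangoldt n with ha
  have hS : ∀ t : ℝ, LSeriesSummable a ((2 : ℝ) + t * I) := fun t ↦
    χ.LSeriesSummable_twist_vonMangoldt (by simp)
  refine hk.bdd_mul (c := ∑' n, ‖LSeries.term a 2 n‖ + 1)
    (continuous_logDeriv_regularizedL χ).neg.aestronglyMeasurable (.of_forall fun t ↦ ?_)
  rw [regularizedL_logDeriv χ (by simp)]
  refine (norm_sub_le _ _).trans (add_le_add ?_ ?_)
  · refine (norm_tsum_le_tsum_norm (hS t).norm).trans (le_of_eq (tsum_congr fun n ↦ ?_))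
    rw [LSeries.norm_term_eq, LSeries.norm_term_eq]
    simp
  · rw [norm_div]
    refine div_le_one_of_le₀ (le_trans ?_ (one_le_norm_sub_one t)) (norm_nonneg _)
    unfold poleOrder
    split_ifs <;> simp

theorem integral_logDeriv_regularizedL (χ : DirichletCharacter ℂ N) {y : ℝ} (hy : 1 ≤ y) :
    ∫ t : ℝ, -(deriv (regularizedL χ) ((2 : ℝ) + t * I) / regularizedL χ ((2 : ℝ) + t * I)) *
        ((y : ℂ) ^ ((2 : ℝ) + t * I : ℂ) *
          (1 / (((2 : ℝ) + t * I : ℂ) * ((2 : ℝ) + t * I + 1)))) =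
      2 * Real.pi * (∑ n ∈ Finset.Icc 1 ⌊y⌋₊, χ n * ArithmeticFunction.vonMangoldt n *
        (1 - n / y) - poleOrder χ * ((y - 1) ^ 2 / (2 * y))) := by
  have hy0 : 0 < y := by linarith
  have hyc : (y : ℂ) ≠ 0 := by exact_mod_cast hy0.ne'
  have h1 := hasSum_integral_LSeries_term χ hy0
  have h2 := mellinInv_max_one_sub_sq_div (inv_pos.mpr hy0)
  have hint := integrable_logDeriv_regularizedL χ hy0
  have h3 : ∀ t : ℝ, (((y⁻¹ : ℝ) : ℂ) ^ (-((2 : ℝ) + t * I : ℂ)) * (1 / ((2 : ℝ) + t * I - 1) *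
      (1 / (((2 : ℝ) + t * I : ℂ) * ((2 : ℝ) + t * I + 1))))) =
      1 / ((2 : ℝ) + t * I - 1) * ((y : ℂ) ^ ((2 : ℝ) + t * I : ℂ) *
      (1 / (((2 : ℝ) + t * I : ℂ) * ((2 : ℝ) + t * I + 1)))) := fun t ↦ by
    rw [ofReal_inv, inv_cpow, cpow_neg, inv_inv]
    · ring
    · rw [arg_ofReal_of_nonneg hy0.le]
      exact Real.pi_ne_zero.symm
  simp_rw [h3] at h2
  have hk : Integrable fun t : ℝ ↦ 1 / ((2 : ℝ) + t * I - 1) * ((y : ℂ) ^ ((2 : ℝ) + t * I : ℂ) *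
      (1 / (((2 : ℝ) + t * I : ℂ) * ((2 : ℝ) + t * I + 1)))) := by
    refine (integrable_cpow_mul_one_div hy0).bdd_mul (c := 1) ?_ (.of_forall fun t ↦ ?_)
    · exact (by fun_prop : Measurable _).aestronglyMeasurable
    · rw [norm_div, norm_one]
      exact div_le_one_of_le₀ (one_le_norm_sub_one t) (norm_nonneg _)
  have hΛ : Integrable fun t : ℝ ↦
      LSeries (fun n ↦ χ n * ArithmeticFunction.vonMangoldt n) ((2 : ℝ) + t * I) *
      ((y : ℂ) ^ ((2 : ℝ) + t * I : ℂ) *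
      (1 / (((2 : ℝ) + t * I : ℂ) * ((2 : ℝ) + t * I + 1)))) := by
    refine (hint.add (hk.const_mul (poleOrder χ : ℂ))).congr (.of_forall fun t ↦ ?_)
    simp only [Pi.add_apply]
    rw [regularizedL_logDeriv χ (by simp)]
    ring
  have h4 : ∀ t : ℝ,
      -(deriv (regularizedL χ) ((2 : ℝ) + t * I) / regularizedL χ ((2 : ℝ) + t * I)) *
        ((y : ℂ) ^ ((2 : ℝ) + t * I : ℂ) *
          (1 / (((2 : ℝ) + t * I : ℂ) * ((2 : ℝ) + t * I + 1)))) =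
      LSeries (fun n ↦ χ n * ArithmeticFunction.vonMangoldt n) ((2 : ℝ) + t * I) *
        ((y : ℂ) ^ ((2 : ℝ) + t * I : ℂ) *
          (1 / (((2 : ℝ) + t * I : ℂ) * ((2 : ℝ) + t * I + 1)))) -
      poleOrder χ * (1 / ((2 : ℝ) + t * I - 1) * ((y : ℂ) ^ ((2 : ℝ) + t * I : ℂ) *
          (1 / (((2 : ℝ) + t * I : ℂ) * ((2 : ℝ) + t * I + 1))))) := fun t ↦ by
    rw [regularizedL_logDeriv χ (by simp)]
    ring
  simp_rw [h4]
  rw [integral_sub hΛ (hk.const_mul _), integral_const_mul, h2]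
  have h5 := h1.unique (hasSum_sum_of_ne_finset_zero (s := Finset.Icc 1 ⌊y⌋₊) fun n hn ↦ ?_)
  · rw [h5, mul_sub, Finset.mul_sum]
    congr 1
    · refine Finset.sum_congr rfl fun n hn ↦ ?_
      have : (n : ℝ) ≤ y := (Nat.le_floor_iff hy0.le).mp (Finset.mem_Icc.mp hn).2
      rw [max_eq_left (by rw [sub_nonneg]; exact div_le_one_of_le₀ this hy0.le)]
      push_cast
      ring
    · rw [max_eq_left (by rw [sub_nonneg]; exact inv_le_one_of_one_le₀ hy)]
      push_cast
      field_simp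
  · rcases eq_or_ne n 0 with rfl | hn0
    · simp
    · have : y < n := by
        rw [Finset.mem_Icc, not_and] at hn
        exact Nat.lt_of_floor_lt (not_le.mp (hn (Nat.one_le_iff_ne_zero.mpr hn0)))
      rw [max_eq_right (by rw [sub_nonpos, one_le_div hy0]; exact this.le)]
      simp

end PerronFormula

section ContourShift

open Complex Set Filter MeasureTheory DirichletCharacter Topology

theorem integral_vertical_eq_of_decay {G : ℂ → ℂ} {a b B r : ℝ} (hab : a ≤ b) (hr : 1 < r)
    (hG : ∀ s : ℂ, a ≤ s.re → DifferentiableAt ℂ G s)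
    (hB : ∀ s : ℂ, a ≤ s.re → s.re ≤ b → ‖G s‖ ≤ B * (1 + |s.im|) ^ (-r)) :
    ∫ t : ℝ, G (b + t * I) = ∫ t : ℝ, G (a + t * I) := by
  have hint : ∀ c : ℝ, a ≤ c → c ≤ b → Integrable fun t : ℝ ↦ G (c + t * I) := fun c hac hcb ↦ by
    have h1 : Integrable fun t : ℝ ↦ B * (1 + ‖t‖) ^ (-r) :=
      (integrable_one_add_norm (by simpa using hr)).const_mul B
    refine h1.mono' (Continuous.aestronglyMeasurable ?_) (.of_forall fun t ↦ ?_)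
    · refine continuous_iff_continuousAt.mpr fun t ↦ ?_
      exact ContinuousAt.comp (f := fun t : ℝ ↦ (c + t * I : ℂ))
        (hG _ (by simpa using hac)).continuousAt (by fun_prop)
    · simpa using hB (c + t * I) (by simpa using hac) (by simpa using hcb)
  have hlim : ∀ c : ℝ, a ≤ c → c ≤ b → Tendsto (fun T : ℝ ↦ ∫ t in (-T)..T, G (c + t * I)) atTop
      (𝓝 (∫ t : ℝ, G (c + t * I))) := fun c hac hcb ↦
    intervalIntegral_tendsto_integral (hint c hac hcb) tendsto_neg_atTop_atBot tendsto_id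
  have hhor : ∀ ε : ℝ, |ε| = 1 →
      Tendsto (fun T : ℝ ↦ ∫ x in a..b, G (x + (ε * T : ℝ) * I)) atTop (𝓝 0) := fun ε hε ↦ by
    have h0 : Tendsto (fun T : ℝ ↦ B * (1 + T) ^ (-r) * |b - a|) atTop (𝓝 0) := by
      have := (tendsto_rpow_neg_atTop (show 0 < r by linarith)).comp
        (tendsto_atTop_add_const_left atTop (1 : ℝ) tendsto_id)
      simpa using (this.const_mul B).mul_const |b - a|
    refine squeeze_zero_norm' ((eventually_ge_atTop 0).mono fun T hT ↦ ?_) h0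
    refine intervalIntegral.norm_integral_le_of_norm_le_const fun x hx ↦ ?_
    rw [uIoc_of_le hab] at hx
    have := hB (x + (ε * T : ℝ) * I) (by simpa using hx.1.le) (by simpa using hx.2)
    have him : ((x : ℂ) + (ε * T : ℝ) * I).im = ε * T := by simp
    rwa [him, abs_mul, hε, one_mul, abs_of_nonneg hT] at this
  have hrect : ∀ T : ℝ, (∫ t in (-T)..T, G (b + t * I)) - ∫ t in (-T)..T, G (a + t * I) =
      I * ((∫ x in a..b, G (x + ((-1) * T : ℝ) * I)) - ∫ x in a..b, G (x + (1 * T : ℝ) * I)) :=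
    fun T ↦ by
    have := integral_boundary_rect_eq_zero_of_differentiableOn G (⟨a, -T⟩ : ℂ) ⟨b, T⟩
      fun s hs ↦ (hG s ?_).differentiableWithinAt
    · simp only [smul_eq_mul] at this
      rw [neg_one_mul, one_mul]
      linear_combination (-I) * this + ((∫ t in (-T)..T, G (b + t * I)) -
        ∫ t in (-T)..T, G (a + t * I)) * I_sq
    · have := (mem_reProdIm.mp hs).1
      simp only [uIcc_of_le hab] at this
      exact this.1
  have h1 := (hlim b hab le_rfl).sub (hlim a le_rfl hab)
  have h2 := ((hhor (-1) (by simp)).sub (hhor 1 (by simp))).const_mul I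
  simp_rw [hrect] at h1
  have h3 := tendsto_nhds_unique h1 h2
  rw [sub_zero, mul_zero] at h3
  exact sub_eq_zero.mp h3

end ContourShift

section SmoothedBound

open Complex Set Filter MeasureTheory DirichletCharacter

theorem half_one_add_abs_le_norm {s : ℂ} (hs : 3 / 5 ≤ s.re) : (1 + |s.im|) / 2 ≤ ‖s‖ := by
  refine abs_le_of_sq_le_sq' ?_ (norm_nonneg s) |>.2
  rw [← normSq_eq_norm_sq, normSq_apply]
  have := abs_nonneg s.im
  have h2 : s.im * s.im = |s.im| * |s.im| := (abs_mul_abs_self _).symm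
  rw [h2]
  nlinarith [sq_nonneg (|s.im| - 1 / 3)]

theorem norm_cpow_sub_cpow_le {y h : ℝ} (hy : 0 < y) (hh : 0 ≤ h) (hhy : h ≤ y) {s : ℂ}
    (hs : s.re = 3 / 5) :
    ‖((y + h : ℝ) : ℂ) ^ (s + 1) - (y : ℂ) ^ (s + 1)‖ ≤
      4 * ‖s + 1‖ ^ (9 / 10 : ℝ) * h ^ (9 / 10 : ℝ) * y ^ (7 / 10 : ℝ) := by
  have hs1 : s + 1 ≠ 0 := fun h ↦ by
    rw [eq_neg_of_add_eq_zero_left h] at hs; norm_num at hs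
  have h1 : ‖((y + h : ℝ) : ℂ) ^ (s + 1) - (y : ℂ) ^ (s + 1)‖ ≤
      ‖s + 1‖ * (2 * y) ^ (3 / 5 : ℝ) * h := by
    have := norm_image_sub_le_of_norm_deriv_le_segment' (f := fun u : ℝ ↦ (u : ℂ) ^ (s + 1))
      (f' := fun u ↦ (s + 1) * (u : ℂ) ^ (s + 1 - 1)) (a := y) (b := y + h)
      (C := ‖s + 1‖ * (2 * y) ^ (3 / 5 : ℝ)) (fun u hu ↦ ?_) (fun u hu ↦ ?_) (y + h)
      ⟨by linarith, le_rfl⟩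
    · simpa using this
    · exact (hasDerivAt_ofReal_cpow_const (by linarith [hu.1] : 0 < u).ne' hs1).hasDerivWithinAt
    · have hu0 : 0 < u := by linarith [hu.1]
      rw [norm_mul, norm_cpow_eq_rpow_re_of_pos hu0, add_sub_cancel_right, hs]
      gcongr
      linarith [hu.2]
  have h2 : ‖((y + h : ℝ) : ℂ) ^ (s + 1) - (y : ℂ) ^ (s + 1)‖ ≤ 2 * (2 * y) ^ (8 / 5 : ℝ) := by
    refine (norm_sub_le _ _).trans ?_
    rw [norm_cpow_eq_rpow_re_of_pos hy, norm_cpow_eq_rpow_re_of_pos (by linarith), add_re, hs,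
      one_re, two_mul, show (3 / 5 + 1 : ℝ) = 8 / 5 by norm_num]
    gcongr <;> linarith
  set X := ‖((y + h : ℝ) : ℂ) ^ (s + 1) - (y : ℂ) ^ (s + 1)‖ with hX
  have hX0 : 0 ≤ X := norm_nonneg _
  have hn : 0 ≤ ‖s + 1‖ := norm_nonneg _
  calc X = X ^ (9 / 10 : ℝ) * X ^ (1 / 10 : ℝ) := by
        rw [← Real.rpow_add_of_nonneg hX0 (by norm_num) (by norm_num)]
        norm_num
    _ ≤ (‖s + 1‖ * (2 * y) ^ (3 / 5 : ℝ) * h) ^ (9 / 10 : ℝ) *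
        (2 * (2 * y) ^ (8 / 5 : ℝ)) ^ (1 / 10 : ℝ) := by gcongr
    _ = (2 : ℝ) ^ (8 / 10 : ℝ) *
        (‖s + 1‖ ^ (9 / 10 : ℝ) * h ^ (9 / 10 : ℝ) * y ^ (7 / 10 : ℝ)) := by
        rw [Real.mul_rpow (by positivity) hh, Real.mul_rpow hn (by positivity),
          Real.mul_rpow zero_le_two (by positivity : 0 ≤ (2 * y) ^ (8 / 5 : ℝ)),
          ← Real.rpow_mul (by positivity), ← Real.rpow_mul (by positivity),
          Real.mul_rpow (by norm_num) hy.le,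
          Real.mul_rpow (by norm_num) hy.le]
        rw [show (8 / 10 : ℝ) = 3 / 5 * (9 / 10) + 1 / 10 + 8 / 5 * (1 / 10) by norm_num,
          show (7 / 10 : ℝ) = 3 / 5 * (9 / 10) + 8 / 5 * (1 / 10) by norm_num,
          Real.rpow_add two_pos, Real.rpow_add two_pos, Real.rpow_add hy]
        ring
    _ ≤ 4 * (‖s + 1‖ ^ (9 / 10 : ℝ) * h ^ (9 / 10 : ℝ) * y ^ (7 / 10 : ℝ)) := by
        gcongr
        calc (2 : ℝ) ^ (8 / 10 : ℝ) ≤ 2 ^ (2 : ℝ) :=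
              Real.rpow_le_rpow_of_exponent_le one_le_two (by norm_num)
          _ = 4 := by norm_num
    _ = _ := by ring

/-- The smoothed Chebyshev function of `χ` with its main term removed. -/
noncomputable def smoothedRemainder {N : ℕ} [NeZero N] (χ : DirichletCharacter ℂ N) (y : ℝ) : ℂ :=
  ∑ n ∈ Finset.Icc 1 ⌊y⌋₊, χ n * ArithmeticFunction.vonMangoldt n * (y - n) -
    poleOrder χ * ((y - 1) ^ 2 / 2)

theorem integral_logDeriv_eq_smoothedRemainder {N : ℕ} [NeZero N] {χ : DirichletCharacter ℂ N}
    (hχ : ∀ s : ℂ, LFunction χ s = 0 → 0 < s.re → s.re < 1 → s.re = 1 / 2) {K : ℝ} (hK : 0 ≤ K)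
    (hb : ∀ s : ℂ, 3 / 5 ≤ s.re → s.re ≤ 2 →
      ‖deriv (regularizedL χ) s / regularizedL χ s‖ ≤ K * (1 + |s.im|) ^ (1 / 20 : ℝ))
    {y : ℝ} (hy : 1 ≤ y) :
    (Integrable fun t : ℝ ↦ -(deriv (regularizedL χ) ((3 / 5 : ℝ) + t * I) /
        regularizedL χ ((3 / 5 : ℝ) + t * I)) * ((y : ℂ) ^ ((3 / 5 : ℝ) + t * I + 1 : ℂ) *
        (1 / (((3 / 5 : ℝ) + t * I : ℂ) * ((3 / 5 : ℝ) + t * I + 1))))) ∧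
    ∫ t : ℝ, -(deriv (regularizedL χ) ((3 / 5 : ℝ) + t * I) /
        regularizedL χ ((3 / 5 : ℝ) + t * I)) * ((y : ℂ) ^ ((3 / 5 : ℝ) + t * I + 1 : ℂ) *
        (1 / (((3 / 5 : ℝ) + t * I : ℂ) * ((3 / 5 : ℝ) + t * I + 1)))) =
      2 * Real.pi * smoothedRemainder χ y := by
  have hy0 : 0 < y := by linarith
  have hyc : (y : ℂ) ≠ 0 := by exact_mod_cast hy0.ne'
  set G : ℂ → ℂ := fun s ↦ -(deriv (regularizedL χ) s / regularizedL χ s) *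
    ((y : ℂ) ^ (s + 1) * (1 / (s * (s + 1)))) with hG
  have hd : ∀ s : ℂ, 3 / 5 ≤ s.re → DifferentiableAt ℂ G s := fun s hs ↦ by
    have hs0 : s ≠ 0 := fun h ↦ by rw [h] at hs; norm_num at hs
    have hs1 : s + 1 ≠ 0 := fun h ↦ by
      rw [eq_neg_of_add_eq_zero_left h] at hs; norm_num at hs
    have h1 := differentiable_regularizedL χ
    have h2 : regularizedL χ s ≠ 0 := regularizedL_ne_zero hχ (by linarith)
    refine (((h1.deriv s).div (h1 s) h2).neg).mul (DifferentiableAt.mul ?_ ?_)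
    · exact DifferentiableAt.const_cpow (by fun_prop) (.inl hyc)
    · exact DifferentiableAt.div (by fun_prop) (by fun_prop) (mul_ne_zero hs0 hs1)
  have hB : ∀ s : ℂ, 3 / 5 ≤ s.re → s.re ≤ 2 →
      ‖G s‖ ≤ (4 * K * y ^ (3 : ℝ)) * (1 + |s.im|) ^ (-(39 / 20) : ℝ) := fun s hs hs2 ↦ by
    have h1 := half_one_add_abs_le_norm hs
    have h2 := half_one_add_abs_le_norm (s := s + 1) (by rw [add_re, one_re]; linarith)
    rw [add_im, one_im, add_zero] at h2
    have hp : 0 < 1 + |s.im| := by positivity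
    simp only [hG]
    rw [norm_mul, norm_neg, norm_mul, norm_div (1 : ℂ), norm_one, norm_mul,
      norm_cpow_eq_rpow_re_of_pos hy0]
    calc _ ≤ (K * (1 + |s.im|) ^ (1 / 20 : ℝ)) * (y ^ (3 : ℝ) *
          (1 / ((1 + |s.im|) / 2 * ((1 + |s.im|) / 2)))) := by
          gcongr
          · exact hb s hs hs2
          · rw [add_re, one_re]
            linarith
      _ = _ := by
          rw [show (-(39 / 20) : ℝ) = 1 / 20 - (2 : ℕ) by norm_num, Real.rpow_sub hp,
            Real.rpow_natCast]
          field_simp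
          ring
  have hmain := integral_vertical_eq_of_decay (a := 3 / 5) (b := 2) (by norm_num)
    (by norm_num) hd hB
  refine ⟨?_, ?_⟩
  · refine ((integrable_one_add_norm (r := 39 / 20) (by simp; norm_num)).const_mul
      (4 * K * y ^ (3 : ℝ))).mono' (Continuous.aestronglyMeasurable ?_) (.of_forall fun t ↦ ?_)
    · refine continuous_iff_continuousAt.mpr fun t ↦ ?_
      exact ContinuousAt.comp (f := fun t : ℝ ↦ ((3 / 5 : ℝ) + t * I : ℂ))
        (hd _ (by simp)).continuousAt (by fun_prop)
    · have := hB ((3 / 5 : ℝ) + t * I) (by simp) (by simp; norm_num)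
      rwa [show ((3 / 5 : ℝ) + t * I : ℂ).im = t by simp] at this
  · refine hmain.symm.trans ?_
    have h2 := integral_logDeriv_regularizedL χ hy
    have h3 : ∀ t : ℝ, G ((2 : ℝ) + t * I) = y *
        (-(deriv (regularizedL χ) ((2 : ℝ) + t * I) / regularizedL χ ((2 : ℝ) + t * I)) *
        ((y : ℂ) ^ ((2 : ℝ) + t * I : ℂ) *
          (1 / (((2 : ℝ) + t * I : ℂ) * ((2 : ℝ) + t * I + 1))))) := fun t ↦ by
      simp only [hG]
      rw [cpow_add _ _ hyc, cpow_one]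
      ring
    simp_rw [h3]
    rw [integral_const_mul, h2, smoothedRemainder, mul_left_comm, mul_sub, Finset.mul_sum]
    congr 2
    · refine Finset.sum_congr rfl fun n _ ↦ ?_
      field_simp
    · field_simp

/-- Under the Riemann hypothesis for `L(s, χ)`, increments of the smoothed remainder are small. -/
theorem exists_norm_smoothedRemainder_sub_le : ∃ C : ℝ, 0 < C ∧
    ∀ (N : ℕ) [NeZero N] (χ : DirichletCharacter ℂ N), 3 ≤ N →
      (∀ s : ℂ, LFunction χ s = 0 → 0 < s.re → s.re < 1 → s.re = 1 / 2) →
      ∀ y h : ℝ, 1 ≤ y → 0 ≤ h → h ≤ y →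
        ‖smoothedRemainder χ (y + h) - smoothedRemainder χ y‖ ≤
          C * Real.log N * h ^ (9 / 10 : ℝ) * y ^ (7 / 10 : ℝ) := by
  obtain ⟨K, hK0, hK⟩ := exists_norm_logDeriv_regularizedL_le
  set J : ℝ := ∫ t : ℝ, (1 + ‖t‖) ^ (-(21 / 20) : ℝ) with hJ
  have hJ0 : 0 ≤ J := integral_nonneg fun t ↦ by positivity
  have hJi : Integrable fun t : ℝ ↦ (1 + ‖t‖) ^ (-(21 / 20) : ℝ) :=
    integrable_one_add_norm (by simp; norm_num)
  refine ⟨16 * K * (J + 1), by positivity, fun N _ χ hN hχ y h hy hh hhy ↦ ?_⟩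
  have hlog : 0 ≤ Real.log N := Real.log_natCast_nonneg N
  have hb := hK N χ hN hχ
  obtain ⟨hi1, he1⟩ := integral_logDeriv_eq_smoothedRemainder hχ (by positivity) hb hy
  obtain ⟨hi2, he2⟩ := integral_logDeriv_eq_smoothedRemainder hχ (by positivity) hb
    (show 1 ≤ y + h by linarith)
  have hdiff : 2 * Real.pi * (smoothedRemainder χ (y + h) - smoothedRemainder χ y) =
      ∫ t : ℝ, -(deriv (regularizedL χ) ((3 / 5 : ℝ) + t * I) /
        regularizedL χ ((3 / 5 : ℝ) + t * I)) *
        ((((y + h : ℝ) : ℂ) ^ ((3 / 5 : ℝ) + t * I + 1 : ℂ) -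
          (y : ℂ) ^ ((3 / 5 : ℝ) + t * I + 1 : ℂ)) *
        (1 / (((3 / 5 : ℝ) + t * I : ℂ) * ((3 / 5 : ℝ) + t * I + 1)))) := by
    rw [mul_sub, ← he1, ← he2, ← integral_sub hi2 hi1]
    congr 1
    ext t
    ring
  have hbound : ‖(2 * Real.pi * (smoothedRemainder χ (y + h) - smoothedRemainder χ y) : ℂ)‖ ≤
      ∫ t : ℝ, (16 * K * Real.log N * h ^ (9 / 10 : ℝ) * y ^ (7 / 10 : ℝ)) *
        (1 + ‖t‖) ^ (-(21 / 20) : ℝ) := by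
    rw [hdiff]
    refine norm_integral_le_of_norm_le (hJi.const_mul _) (.of_forall fun t ↦ ?_)
    set s : ℂ := (3 / 5 : ℝ) + t * I with hs
    have hre : s.re = 3 / 5 := by simp [hs]
    have him : s.im = t := by simp [hs]
    have h1 := half_one_add_abs_le_norm hre.ge
    have h2 := half_one_add_abs_le_norm (s := s + 1) (by rw [add_re, one_re]; linarith)
    rw [add_im, one_im, add_zero] at h2
    rw [him] at h1 h2
    have hp : 0 < 1 + |t| := by positivity
    have hn1 : 0 < ‖s + 1‖ := lt_of_lt_of_le (by positivity) h2
    have hn0 : 0 < ‖s‖ := lt_of_lt_of_le (by positivity) h1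
    have h3 := hb s hre.ge (by linarith)
    rw [him] at h3
    have h4 := norm_cpow_sub_cpow_le (by linarith) hh hhy hre
    rw [norm_mul, norm_neg, norm_mul, norm_div (1 : ℂ), norm_one, norm_mul, Real.norm_eq_abs]
    have h5 : ‖s + 1‖ ^ (9 / 10 : ℝ) * (1 / (‖s‖ * ‖s + 1‖)) ≤
        4 * (1 + |t|) ^ (-(11 / 10) : ℝ) := by
      have e1 : ‖s + 1‖ ^ (9 / 10 : ℝ) * (1 / (‖s‖ * ‖s + 1‖)) =
          ‖s‖⁻¹ * ‖s + 1‖ ^ (-(1 / 10) : ℝ) := by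
        rw [show (-(1 / 10) : ℝ) = 9 / 10 - 1 by norm_num, Real.rpow_sub hn1, Real.rpow_one]
        field_simp
      rw [e1]
      calc _ ≤ ((1 + |t|) / 2)⁻¹ * ((1 + |t|) / 2) ^ (-(1 / 10) : ℝ) := by
            gcongr ?_ * ?_
            · exact inv_anti₀ (by positivity) h1
            · exact Real.rpow_le_rpow_of_nonpos (by positivity) h2 (by norm_num)
        _ = ((1 + |t|) / 2) ^ (-(11 / 10) : ℝ) := by
            rw [← Real.rpow_neg_one, ← Real.rpow_add (by positivity)]
            norm_num
        _ = (2 : ℝ) ^ (11 / 10 : ℝ) * (1 + |t|) ^ (-(11 / 10) : ℝ) := by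
            rw [Real.div_rpow hp.le zero_le_two, Real.rpow_neg zero_le_two, div_inv_eq_mul,
              mul_comm]
        _ ≤ 4 * (1 + |t|) ^ (-(11 / 10) : ℝ) := by
            gcongr
            calc (2 : ℝ) ^ (11 / 10 : ℝ) ≤ 2 ^ (2 : ℝ) :=
                  Real.rpow_le_rpow_of_exponent_le one_le_two (by norm_num)
              _ = 4 := by norm_num
    calc _ ≤ (K * Real.log N * (1 + |t|) ^ (1 / 20 : ℝ)) *
          ((4 * ‖s + 1‖ ^ (9 / 10 : ℝ) * h ^ (9 / 10 : ℝ) * y ^ (7 / 10 : ℝ)) *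
            (1 / (‖s‖ * ‖s + 1‖))) := by gcongr
      _ = (4 * K * Real.log N * (1 + |t|) ^ (1 / 20 : ℝ) * h ^ (9 / 10 : ℝ) * y ^ (7 / 10 : ℝ)) *
          (‖s + 1‖ ^ (9 / 10 : ℝ) * (1 / (‖s‖ * ‖s + 1‖))) := by ring
      _ ≤ (4 * K * Real.log N * (1 + |t|) ^ (1 / 20 : ℝ) * h ^ (9 / 10 : ℝ) * y ^ (7 / 10 : ℝ)) *
          (4 * (1 + |t|) ^ (-(11 / 10) : ℝ)) := by gcongr
      _ = _ := by
          rw [show (-(21 / 20) : ℝ) = 1 / 20 + -(11 / 10) by norm_num, Real.rpow_add hp]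
          ring
  rw [integral_const_mul, norm_mul, norm_mul, norm_ofNat, norm_real, Real.norm_eq_abs,
    abs_of_pos Real.pi_pos, ← hJ] at hbound
  have hpi := Real.pi_gt_three
  have hn := norm_nonneg (smoothedRemainder χ (y + h) - smoothedRemainder χ y)
  have hc : 0 ≤ 16 * K * Real.log N * h ^ (9 / 10 : ℝ) * y ^ (7 / 10 : ℝ) := by positivity
  nlinarith

end SmoothedBound

section CharacterPrimeSums

open Complex Set Filter MeasureTheory DirichletCharacter

open ArithmeticFunction (vonMangoldt)

theorem smoothedRemainder_add_sub {N : ℕ} [NeZero N] (χ : DirichletCharacter ℂ N) {y h : ℝ}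
    (hh : 0 ≤ h) :
    smoothedRemainder χ (y + h) - smoothedRemainder χ y =
      h * (∑ n ∈ Finset.Icc 1 ⌊y⌋₊, χ n * vonMangoldt n - poleOrder χ * y) +
      ∑ n ∈ Finset.Ioc ⌊y⌋₊ ⌊y + h⌋₊, χ n * vonMangoldt n * (y + h - n) -
      poleOrder χ * (h ^ 2 / 2 - h) := by
  have hle : ⌊y⌋₊ ≤ ⌊y + h⌋₊ := Nat.floor_mono (by linarith)
  have hsplit : ∑ n ∈ Finset.Icc 1 ⌊y + h⌋₊, χ n * vonMangoldt n * ((y + h : ℝ) - n : ℂ) =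
      ∑ n ∈ Finset.Icc 1 ⌊y⌋₊, χ n * vonMangoldt n * (y + h - n) +
      ∑ n ∈ Finset.Ioc ⌊y⌋₊ ⌊y + h⌋₊, χ n * vonMangoldt n * (y + h - n) := by
    push_cast
    rw [← Finset.sum_union]
    · congr 1
      ext n
      simp only [Finset.mem_union, Finset.mem_Icc, Finset.mem_Ioc]
      omega
    · rw [Finset.disjoint_left]
      intro n hn hn'
      simp only [Finset.mem_Icc, Finset.mem_Ioc] at hn hn'
      omega
  have h2 : ∑ n ∈ Finset.Icc 1 ⌊y⌋₊, χ n * vonMangoldt n * (y + h - n : ℂ) =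
      ∑ n ∈ Finset.Icc 1 ⌊y⌋₊, χ n * vonMangoldt n * (y - n : ℂ) +
      h * ∑ n ∈ Finset.Icc 1 ⌊y⌋₊, χ n * vonMangoldt n := by
    rw [Finset.mul_sum, ← Finset.sum_add_distrib]
    exact Finset.sum_congr rfl fun n _ ↦ by ring
  rw [smoothedRemainder, smoothedRemainder, hsplit, h2]
  push_cast
  ring

theorem norm_sum_Ioc_vonMangoldt_le {N : ℕ} (χ : DirichletCharacter ℂ N) {y h : ℝ}
    (hy : 1 ≤ y) (hh : 0 ≤ h) (hhy : h ≤ y) :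
    ‖∑ n ∈ Finset.Ioc ⌊y⌋₊ ⌊y + h⌋₊, χ n * vonMangoldt n * (y + h - n : ℂ)‖ ≤
      h * ((h + 1) * Real.log (2 * y)) := by
  have hlog : 0 ≤ Real.log (2 * y) := Real.log_nonneg (by linarith)
  have hb : ∀ n ∈ Finset.Ioc ⌊y⌋₊ ⌊y + h⌋₊, ‖(χ n * vonMangoldt n * (y + h - n) : ℂ)‖ ≤
      h * Real.log (2 * y) := fun n hn ↦ by
    obtain ⟨hn1, hn2⟩ := Finset.mem_Ioc.mp hn
    have h1 : y < n := Nat.lt_of_floor_lt hn1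
    have h2 : (n : ℝ) ≤ y + h := (Nat.le_floor_iff (by linarith)).mp hn2
    have h3 : ‖(y + h - n : ℂ)‖ ≤ h := by
      rw [← ofReal_natCast, ← ofReal_add, ← ofReal_sub, norm_real, Real.norm_eq_abs,
        abs_of_nonneg (by linarith)]
      linarith
    have h4 : ‖(vonMangoldt n : ℂ)‖ ≤ Real.log (2 * y) := by
      rw [norm_real, Real.norm_eq_abs, abs_of_nonneg ArithmeticFunction.vonMangoldt_nonneg]
      exact ArithmeticFunction.vonMangoldt_le_log.trans
        (Real.log_le_log (by linarith) (by linarith))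
    rw [norm_mul, norm_mul]
    calc _ ≤ 1 * Real.log (2 * y) * h := by
          gcongr
          exact χ.norm_le_one _
      _ = _ := by ring
  have hcard : ((⌊y + h⌋₊ - ⌊y⌋₊ : ℕ) : ℝ) ≤ h + 1 := by
    rw [Nat.cast_sub (Nat.floor_mono (by linarith))]
    have := Nat.floor_le (show 0 ≤ y + h by linarith)
    have := Nat.lt_floor_add_one y
    linarith
  refine (norm_sum_le_of_le _ hb).trans ?_
  rw [Finset.sum_const, Nat.card_Ioc, nsmul_eq_mul]
  calc _ ≤ (h + 1) * (h * Real.log (2 * y)) := by gcongr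
    _ = _ := by ring

/-- Under the Riemann hypothesis for `L(s, χ)`, a bound for `ψ(y, χ)` with its main term removed. -/
theorem exists_norm_sum_vonMangoldt_sub_le : ∃ C : ℝ, 0 < C ∧
    ∀ (N : ℕ) [NeZero N] (χ : DirichletCharacter ℂ N), 3 ≤ N →
      (∀ s : ℂ, LFunction χ s = 0 → 0 < s.re → s.re < 1 → s.re = 1 / 2) →
      ∀ y : ℝ, 1 ≤ y →
        ‖∑ n ∈ Finset.Icc 1 ⌊y⌋₊, χ n * vonMangoldt n - poleOrder χ * y‖ ≤
          C * Real.log N * y ^ (13 / 20 : ℝ) := by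
  obtain ⟨C, hC0, hC⟩ := exists_norm_smoothedRemainder_sub_le
  refine ⟨C + 40, by positivity, fun N _ χ hN hχ y hy ↦ ?_⟩
  have hN3 : (3 : ℝ) ≤ N := by exact_mod_cast hN
  have hlogN : 1 ≤ Real.log N := by
    rw [Real.le_log_iff_exp_le (by linarith)]
    exact Real.exp_one_lt_d9.le.trans (by linarith)
  have hy0 : 0 < y := by linarith
  set h : ℝ := y ^ (1 / 2 : ℝ) with hh
  have hh1 : 1 ≤ h := Real.one_le_rpow hy (by norm_num)
  have hhy : h ≤ y := by
    calc h ≤ y ^ (1 : ℝ) := Real.rpow_le_rpow_of_exponent_le hy (by norm_num)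
      _ = y := Real.rpow_one y
  have h1 := hC N χ hN hχ y h hy (by linarith) hhy
  have h2 := norm_sum_Ioc_vonMangoldt_le χ hy (show 0 ≤ h by linarith) hhy
  have h3 := smoothedRemainder_add_sub χ (y := y) (show 0 ≤ h by linarith)
  set D : ℂ := ∑ n ∈ Finset.Icc 1 ⌊y⌋₊, χ n * vonMangoldt n - poleOrder χ * y with hD
  set T : ℂ := ∑ n ∈ Finset.Ioc ⌊y⌋₊ ⌊y + h⌋₊, χ n * vonMangoldt n * (y + h - n) with hT
  set P : ℝ := y ^ (13 / 20 : ℝ) with hP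
  have h4 : ‖(poleOrder χ * (h ^ 2 / 2 - h) : ℂ)‖ ≤ h * (2 * h) := by
    rw [norm_mul]
    have e1 : ‖(poleOrder χ : ℂ)‖ ≤ 1 := by unfold poleOrder; split_ifs <;> simp
    have e2 : ‖((h : ℂ) ^ 2 / 2 - h)‖ ≤ h * (2 * h) := by
      rw [show ((h : ℂ) ^ 2 / 2 - h) = ((h ^ 2 / 2 - h : ℝ) : ℂ) by push_cast; ring, norm_real,
        Real.norm_eq_abs, abs_le]
      constructor <;> nlinarith
    nlinarith [norm_nonneg ((h : ℂ) ^ 2 / 2 - h), norm_nonneg (poleOrder χ : ℂ)]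
  have h5 : h * ‖D‖ ≤ C * Real.log N * h ^ (9 / 10 : ℝ) * y ^ (7 / 10 : ℝ) +
      h * ((h + 1) * Real.log (2 * y)) + h * (2 * h) := by
    have e1 : (h : ℂ) * D = (smoothedRemainder χ (y + h) - smoothedRemainder χ y) - T +
        poleOrder χ * (h ^ 2 / 2 - h) := by rw [h3]; ring
    have e2 : h * ‖D‖ = ‖(h : ℂ) * D‖ := by
      rw [norm_mul, norm_real, Real.norm_eq_abs, abs_of_nonneg (by linarith)]
    rw [e2, e1]
    refine (norm_add_le _ _).trans (add_le_add ((norm_sub_le _ _).trans (add_le_add h1 h2)) h4)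
  have h6 : h ^ (9 / 10 : ℝ) * y ^ (7 / 10 : ℝ) = h * P := by
    rw [hh, hP, ← Real.rpow_mul hy0.le, ← Real.rpow_add hy0, ← Real.rpow_add hy0]
    norm_num
  have h7 : ‖D‖ ≤ C * Real.log N * P + (h + 1) * Real.log (2 * y) + 2 * h := by
    rw [mul_assoc _ (h ^ (9 / 10 : ℝ)), h6] at h5
    nlinarith
  have h8 : h ≤ P := Real.rpow_le_rpow_of_exponent_le hy (by norm_num)
  have h9 : h * Real.log (2 * y) ≤ 14 * P := by
    have e1 : Real.log (2 * y) ≤ (2 * y) ^ (3 / 20 : ℝ) / (3 / 20) :=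
      Real.log_le_rpow_div (by positivity) (by norm_num)
    have e2 : (2 : ℝ) ^ (3 / 20 : ℝ) ≤ 2 := by
      calc (2 : ℝ) ^ (3 / 20 : ℝ) ≤ 2 ^ (1 : ℝ) :=
            Real.rpow_le_rpow_of_exponent_le one_le_two (by norm_num)
        _ = 2 := Real.rpow_one 2
    have e3 : h * y ^ (3 / 20 : ℝ) = P := by
      rw [hh, hP, ← Real.rpow_add hy0]
      norm_num
    rw [Real.mul_rpow zero_le_two hy0.le] at e1
    have e4 : 0 ≤ y ^ (3 / 20 : ℝ) := by positivity
    calc h * Real.log (2 * y) ≤ h * (14 * y ^ (3 / 20 : ℝ)) := by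
          gcongr
          refine e1.trans ?_
          rw [div_le_iff₀ (by norm_num)]
          nlinarith
      _ = 14 * P := by rw [← e3]; ring
  have h10 : 0 ≤ Real.log (2 * y) := Real.log_nonneg (by linarith)
  have h11 : (h + 1) * Real.log (2 * y) ≤ 28 * P := by nlinarith
  have hP0 : 1 ≤ P := by linarith
  have h12 : P ≤ Real.log N * P := by nlinarith
  calc ‖D‖ ≤ C * Real.log N * P + 40 * P := by linarith
    _ ≤ C * Real.log N * P + 40 * (Real.log N * P) := by gcongr
    _ = _ := by ring

end CharacterPrimeSums

section PrimeSums

open Complex Set Filter MeasureTheory DirichletCharacter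

open ArithmeticFunction (vonMangoldt)

/-- Under the Riemann hypothesis for `L(s, χ)`, a bound for `θ(y, χ)` with its main term removed. -/
theorem exists_norm_sum_prime_log_sub_le : ∃ C : ℝ, 0 < C ∧
    ∀ (N : ℕ) [NeZero N] (χ : DirichletCharacter ℂ N), 3 ≤ N →
      (∀ s : ℂ, LFunction χ s = 0 → 0 < s.re → s.re < 1 → s.re = 1 / 2) →
      ∀ y : ℝ, 1 ≤ y →
        ‖∑ n ∈ Finset.Icc 0 ⌊y⌋₊, (if n.Prime then χ n * (Real.log n : ℂ) else 0) -
          poleOrder χ * y‖ ≤ C * Real.log N * y ^ (13 / 20 : ℝ) := by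
  obtain ⟨C, hC0, hC⟩ := exists_norm_sum_vonMangoldt_sub_le
  refine ⟨C + 14, by positivity, fun N _ χ hN hχ y hy ↦ ?_⟩
  have hN3 : (3 : ℝ) ≤ N := by exact_mod_cast hN
  have hlogN : 1 ≤ Real.log N := by
    rw [Real.le_log_iff_exp_le (by linarith)]
    exact Real.exp_one_lt_d9.le.trans (by linarith)
  have hy0 : 0 < y := by linarith
  have h1 := hC N χ hN hχ y hy
  have h2 : ∑ n ∈ Finset.Icc 0 ⌊y⌋₊, (if n.Prime then χ n * (Real.log n : ℂ) else 0) =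
      ∑ n ∈ Finset.Icc 1 ⌊y⌋₊, χ n * vonMangoldt n -
      ∑ n ∈ Finset.Ioc 0 ⌊y⌋₊ with ¬ n.Prime, χ n * vonMangoldt n := by
    have e : Finset.Icc 1 ⌊y⌋₊ = Finset.Ioc 0 ⌊y⌋₊ := by ext; simp; omega
    rw [e, ← Finset.sum_filter_add_sum_filter_not (Finset.Ioc 0 ⌊y⌋₊) Nat.Prime
      (fun n ↦ χ n * (vonMangoldt n : ℂ)), add_sub_cancel_right, ← Finset.sum_filter]
    refine Finset.sum_congr ?_ fun n hn ↦ ?_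
    · ext n
      simp only [Finset.mem_filter, Finset.mem_Icc, Finset.mem_Ioc, zero_le, true_and]
      exact ⟨fun h ↦ ⟨⟨h.2.pos, h.1⟩, h.2⟩, fun h ↦ ⟨h.1.2, h.2⟩⟩
    · rw [ArithmeticFunction.vonMangoldt_apply_prime (Finset.mem_filter.mp hn).2]
  have h3 : ‖∑ n ∈ Finset.Ioc 0 ⌊y⌋₊ with ¬ n.Prime, χ n * (vonMangoldt n : ℂ)‖ ≤
      14 * y ^ (13 / 20 : ℝ) := by
    refine (norm_sum_le_of_le (n := fun n ↦ vonMangoldt n) _ fun n _ ↦ ?_).trans ?_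
    · rw [norm_mul, norm_real, Real.norm_eq_abs,
        abs_of_nonneg ArithmeticFunction.vonMangoldt_nonneg]
      exact mul_le_of_le_one_left ArithmeticFunction.vonMangoldt_nonneg (χ.norm_le_one _)
    · rw [← Chebyshev.psi_sub_theta_eq_sum_not_prime]
      refine (Chebyshev.psi_sub_theta_le hy).trans ?_
      have e1 : Real.log y ≤ y ^ (3 / 20 : ℝ) / (3 / 20) :=
        Real.log_le_rpow_div hy0.le (by norm_num)
      have e2 : √y * y ^ (3 / 20 : ℝ) = y ^ (13 / 20 : ℝ) := by
        rw [Real.sqrt_eq_rpow, ← Real.rpow_add hy0]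
        norm_num
      have e3 : 0 ≤ y ^ (3 / 20 : ℝ) := by positivity
      calc 2 * √y * Real.log y ≤ 2 * √y * (7 * y ^ (3 / 20 : ℝ)) := by
            gcongr
            refine e1.trans ?_
            rw [div_le_iff₀ (by norm_num)]
            nlinarith
        _ = 14 * y ^ (13 / 20 : ℝ) := by rw [← e2]; ring
  rw [h2, sub_right_comm]
  have hP : 0 ≤ y ^ (13 / 20 : ℝ) := by positivity
  refine (norm_sub_le _ _).trans ((add_le_add h1 h3).trans ?_)
  nlinarith

theorem continuousOn_inv_log {a b : ℝ} (ha : 1 < a) :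
    ContinuousOn (fun t : ℝ ↦ (Real.log t)⁻¹) (Icc a b) := by
  refine ContinuousOn.inv₀ (Real.continuousOn_log.mono fun t ht ↦ ?_) fun t ht ↦ ?_
  · exact (by linarith [ht.1] : 0 < t).ne'
  · exact (Real.log_pos (by linarith [ht.1])).ne'

theorem hasDerivAt_inv_log {t : ℝ} (ht : 1 < t) :
    HasDerivAt (fun t : ℝ ↦ (Real.log t)⁻¹) (-(1 / (t * Real.log t ^ 2))) t := by
  have hl : Real.log t ≠ 0 := (Real.log_pos ht).ne'
  refine ((Real.hasDerivAt_log (by linarith : t ≠ 0)).inv hl).congr_deriv ?_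
  rw [one_div, mul_inv, neg_div, div_eq_mul_inv]

theorem continuousOn_one_div_mul_log_sq {a b : ℝ} (ha : 1 < a) :
    ContinuousOn (fun t : ℝ ↦ 1 / (t * Real.log t ^ 2)) (Icc a b) := by
  have h1 : ContinuousOn (fun t : ℝ ↦ Real.log t) (Icc a b) :=
    Real.continuousOn_log.mono fun t ht ↦ (by linarith [ht.1] : 0 < t).ne'
  refine continuousOn_const.div (continuousOn_id.mul (h1.pow 2)) fun t ht ↦ ?_
  have h2 : 0 < Real.log t := Real.log_pos (by linarith [ht.1])
  have h3 : 0 < t := by linarith [ht.1]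
  exact (mul_pos h3 (pow_pos h2 2)).ne'

theorem Li_eq {y : ℝ} (hy : 2 ≤ y) :
    Li y = y / Real.log y + (∫ t in (2 : ℝ)..y, t * (1 / (t * Real.log t ^ 2))) -
      2 / Real.log 2 := by
  have hc1 : IntervalIntegrable (fun t : ℝ ↦ (Real.log t)⁻¹) volume 2 y :=
    (by rw [uIcc_of_le hy]; exact continuousOn_inv_log one_lt_two : ContinuousOn _ _)
      |>.intervalIntegrable
  have hc2 : IntervalIntegrable (fun t : ℝ ↦ t * (1 / (t * Real.log t ^ 2))) volume 2 y :=
    (by rw [uIcc_of_le hy]; exact continuousOn_id.mul (continuousOn_one_div_mul_log_sq one_lt_two) :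
      ContinuousOn _ _) |>.intervalIntegrable
  have h1 : Li y = ∫ t in (2 : ℝ)..y, (Real.log t)⁻¹ := by
    unfold Li
    split_ifs with h
    · rw [le_antisymm h hy, intervalIntegral.integral_same]
    · simp
  have h2 := intervalIntegral.integral_eq_sub_of_hasDerivAt (f := fun t : ℝ ↦ t * (Real.log t)⁻¹)
    (f' := fun t ↦ (Real.log t)⁻¹ - t * (1 / (t * Real.log t ^ 2))) (a := 2) (b := y)
    (fun t ht ↦ ?_) (hc1.sub hc2)
  · rw [intervalIntegral.integral_sub hc1 hc2] at h2
    rw [h1, div_eq_mul_inv, div_eq_mul_inv]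
    linarith
  · rw [uIcc_of_le hy] at ht
    refine ((hasDerivAt_id t).mul (hasDerivAt_inv_log (by linarith [ht.1] : 1 < t))).congr_deriv ?_
    rw [id, one_mul, mul_neg, sub_eq_add_neg]

theorem sum_prime_eq_add_integral {N : ℕ} (χ : DirichletCharacter ℂ N) (y : ℝ) :
    ∑ q ∈ Finset.Icc 0 ⌊y⌋₊ with q.Prime, χ q =
      (((Real.log y)⁻¹ : ℝ) : ℂ) *
        (∑ n ∈ Finset.Icc 0 ⌊y⌋₊, if n.Prime then χ n * (Real.log n : ℂ) else 0) +
      ∫ t in Ioc 2 y, ((1 / (t * Real.log t ^ 2) : ℝ) : ℂ) *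
        (∑ n ∈ Finset.Icc 0 ⌊t⌋₊, if n.Prime then χ n * (Real.log n : ℂ) else 0) := by
  set c : ℕ → ℂ := fun n ↦ if n.Prime then χ n * (Real.log n : ℂ) else 0 with hc
  have hder : ∀ t : ℝ, 2 ≤ t → HasDerivAt (fun t : ℝ ↦ (((Real.log t)⁻¹ : ℝ) : ℂ))
      ((-(1 / (t * Real.log t ^ 2)) : ℝ) : ℂ) t := fun t ht ↦
    (hasDerivAt_inv_log (by linarith)).ofReal_comp
  have h := sum_mul_eq_sub_integral_mul₁ c (f := fun t : ℝ ↦ (((Real.log t)⁻¹ : ℝ) : ℂ))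
    (by simp [hc]) (by simp [hc]) y (fun t ht ↦ (hder t ht.1).differentiableAt) ?_
  · have h1 : ∑ q ∈ Finset.Icc 0 ⌊y⌋₊ with q.Prime, χ q =
        ∑ k ∈ Finset.Icc 0 ⌊y⌋₊, (((Real.log k)⁻¹ : ℝ) : ℂ) * c k := by
      rw [Finset.sum_filter]
      refine Finset.sum_congr rfl fun n _ ↦ ?_
      simp only [hc]
      split_ifs with hn
      · have : (Real.log n : ℂ) ≠ 0 := by
          exact_mod_cast (Real.log_pos (by exact_mod_cast hn.one_lt)).ne'
        push_cast at this ⊢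
        field_simp
      · simp
    rw [h1, h, sub_eq_add_neg, ← integral_neg]
    congr 1
    refine setIntegral_congr_fun measurableSet_Ioc fun t ht ↦ ?_
    rw [(hder t ht.1.le).deriv, ofReal_neg, neg_mul, neg_neg]
  · have : ContinuousOn (fun t : ℝ ↦ ((-(1 / (t * Real.log t ^ 2)) : ℝ) : ℂ)) (Icc 2 y) :=
      continuous_ofReal.comp_continuousOn (continuousOn_one_div_mul_log_sq one_lt_two).neg
    refine (this.integrableOn_compact isCompact_Icc).congr_fun (fun t ht ↦ ?_) measurableSet_Icc
    exact (hder t ht.1).deriv.symm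

theorem integrableOn_sum_prime_log {N : ℕ} (χ : DirichletCharacter ℂ N) (y : ℝ) :
    IntegrableOn (fun t : ℝ ↦ ((1 / (t * Real.log t ^ 2) : ℝ) : ℂ) *
      (∑ n ∈ Finset.Icc 0 ⌊t⌋₊, if n.Prime then χ n * (Real.log n : ℂ) else 0)) (Ioc 2 y) := by
  have h1 : ContinuousOn (fun t : ℝ ↦ ((1 / (t * Real.log t ^ 2) : ℝ) : ℂ)) (Icc 2 y) :=
    continuous_ofReal.comp_continuousOn (continuousOn_one_div_mul_log_sq one_lt_two)
  exact (integrableOn_mul_sum_Icc _ (by norm_num)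
    (h1.integrableOn_compact isCompact_Icc)).mono_set Ioc_subset_Icc_self

/-- The prime number theorem for `χ` with a power saving, under the Riemann hypothesis for
`L(s, χ)`. -/
theorem exists_norm_sum_prime_sub_le : ∃ C : ℝ, 0 < C ∧
    ∀ (N : ℕ) [NeZero N] (χ : DirichletCharacter ℂ N), 3 ≤ N →
      (∀ s : ℂ, LFunction χ s = 0 → 0 < s.re → s.re < 1 → s.re = 1 / 2) →
      ∀ y : ℝ, 0 < y →
        ‖∑ q ∈ Finset.Icc 0 ⌊y⌋₊ with q.Prime, χ q - poleOrder χ * Li y‖ ≤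
          C * Real.log N * y ^ (13 / 20 : ℝ) := by
  obtain ⟨C, hC0, hC⟩ := exists_norm_sum_prime_log_sub_le
  refine ⟨7 * C + 3, by positivity, fun N _ χ hN hχ y hy ↦ ?_⟩
  have hN3 : (3 : ℝ) ≤ N := by exact_mod_cast hN
  have hlogN : 1 ≤ Real.log N := by
    rw [Real.le_log_iff_exp_le (by linarith)]
    exact Real.exp_one_lt_d9.le.trans (by linarith)
  rcases lt_or_ge y 2 with hy2 | hy2
  · have h1 : ∑ q ∈ Finset.Icc 0 ⌊y⌋₊ with q.Prime, χ q = 0 := by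
      refine Finset.sum_eq_zero fun q hq ↦ ?_
      simp only [Finset.mem_filter, Finset.mem_Icc, zero_le, true_and] at hq
      have := (Nat.le_floor_iff hy.le).mp hq.1
      have : (2 : ℝ) ≤ q := by exact_mod_cast hq.2.two_le
      linarith
    rw [h1, Li, if_pos hy2.le]
    simp only [ofReal_zero, mul_zero, sub_zero, norm_zero]
    positivity
  set Θ : ℝ → ℂ := fun t ↦ ∑ n ∈ Finset.Icc 0 ⌊t⌋₊, if n.Prime then χ n * (Real.log n : ℂ) else 0
    with hΘ
  set w : ℝ → ℝ := fun t ↦ 1 / (t * Real.log t ^ 2) with hw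
  have hE : ∀ t : ℝ, 1 ≤ t → ‖Θ t - poleOrder χ * t‖ ≤ C * Real.log N * t ^ (13 / 20 : ℝ) :=
    fun t ht ↦ hC N χ hN hχ t ht
  have hlog2 : 0.69 < Real.log 2 := lt_trans (by norm_num) Real.log_two_gt_d9
  have hlog : ∀ t : ℝ, 2 ≤ t → 0.69 < Real.log t := fun t ht ↦
    hlog2.trans_le (Real.log_le_log two_pos ht)
  have hwi : IntegrableOn (fun t : ℝ ↦ (w t : ℂ) * (poleOrder χ * t)) (Ioc 2 y) := by
    have : ContinuousOn (fun t : ℝ ↦ (w t : ℂ) * (poleOrder χ * t)) (Icc 2 y) :=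
      (continuous_ofReal.comp_continuousOn (continuousOn_one_div_mul_log_sq one_lt_two)).mul
        (by fun_prop)
    exact (this.integrableOn_compact isCompact_Icc).mono_set Ioc_subset_Icc_self
  have hkey : ∑ q ∈ Finset.Icc 0 ⌊y⌋₊ with q.Prime, χ q - poleOrder χ * Li y =
      (((Real.log y)⁻¹ : ℝ) : ℂ) * (Θ y - poleOrder χ * y) +
      (∫ t in Ioc 2 y, (w t : ℂ) * (Θ t - poleOrder χ * t)) +
      poleOrder χ * ((2 / Real.log 2 : ℝ) : ℂ) := by
    have h1 : (∫ t in Ioc 2 y, (w t : ℂ) * (Θ t - poleOrder χ * t)) =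
        (∫ t in Ioc 2 y, (w t : ℂ) * Θ t) - ∫ t in Ioc 2 y, (w t : ℂ) * (poleOrder χ * t) := by
      rw [← integral_sub (integrableOn_sum_prime_log χ y) hwi]
      simp only [hw, hΘ, mul_sub]
    have h2 : ∫ t in Ioc 2 y, (w t : ℂ) * (poleOrder χ * t) =
        poleOrder χ * ((∫ t in (2 : ℝ)..y, t * w t : ℝ) : ℂ) := by
      rw [intervalIntegral.integral_of_le hy2, ← integral_complex_ofReal, ← integral_const_mul]
      refine integral_congr_ae (ae_of_all _ fun t ↦ ?_)
      simp only [ofReal_mul]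
      ring
    rw [sum_prime_eq_add_integral, Li_eq hy2, h1, h2]
    simp only [hw, hΘ]
    push_cast
    ring
  have hP0 : (1 : ℝ) ≤ y ^ (13 / 20 : ℝ) := Real.one_le_rpow (by linarith) (by norm_num)
  have hly : (Real.log y)⁻¹ ≤ 2 := by
    rw [inv_le_comm₀ (by linarith [hlog y hy2]) two_pos]
    linarith [hlog y hy2]
  have hly0 : 0 ≤ (Real.log y)⁻¹ := inv_nonneg.mpr (by linarith [hlog y hy2])
  have b1 : ‖(((Real.log y)⁻¹ : ℝ) : ℂ) * (Θ y - poleOrder χ * y)‖ ≤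
      2 * (C * Real.log N * y ^ (13 / 20 : ℝ)) := by
    rw [norm_mul, norm_real, Real.norm_eq_abs, abs_of_nonneg hly0]
    exact mul_le_mul hly (hE y (by linarith)) (norm_nonneg _) two_pos.le
  have b2 : ‖∫ t in Ioc 2 y, (w t : ℂ) * (Θ t - poleOrder χ * t)‖ ≤
      5 * (C * Real.log N * y ^ (13 / 20 : ℝ)) := by
    rw [← intervalIntegral.integral_of_le hy2]
    have hint : IntervalIntegrable (fun t : ℝ ↦ 3 * (C * Real.log N) * t ^ (-7 / 20 : ℝ))
        volume 2 y := by
      refine (intervalIntegral.intervalIntegrable_rpow' (by norm_num)).const_mul _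
    refine (intervalIntegral.norm_integral_le_of_norm_le hy2 (ae_of_all _ fun t ht ↦ ?_)
      hint).trans ?_
    · have ht0 : 0 < t := by linarith [ht.1]
      have hl := hlog t ht.1.le
      have hw3 : |w t| ≤ 3 * t⁻¹ := by
        have hl2 : 1 ≤ 3 * Real.log t ^ 2 := by nlinarith
        rw [abs_of_nonneg (by positivity)]
        simp only [hw]
        rw [one_div, mul_inv, mul_comm]
        gcongr
        rw [inv_le_comm₀ (by positivity) (by norm_num)]
        linarith
      rw [norm_mul, norm_real, Real.norm_eq_abs]
      calc |w t| * ‖Θ t - poleOrder χ * t‖ ≤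
          (3 * t⁻¹) * (C * Real.log N * t ^ (13 / 20 : ℝ)) :=
            mul_le_mul hw3 (hE t (by linarith [ht.1])) (norm_nonneg _) (by positivity)
        _ = 3 * (C * Real.log N) * (t ^ (-1 : ℝ) * t ^ (13 / 20 : ℝ)) := by
            rw [Real.rpow_neg_one]; ring
        _ = _ := by rw [← Real.rpow_add ht0]; norm_num
    · rw [intervalIntegral.integral_const_mul, integral_rpow (Or.inl (by norm_num))]
      have e : (-7 / 20 : ℝ) + 1 = 13 / 20 := by norm_num
      rw [e]
      have h2 : (0 : ℝ) ≤ 2 ^ (13 / 20 : ℝ) := by positivity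
      have h3 : 0 ≤ C * Real.log N := by positivity
      calc 3 * (C * Real.log N) * ((y ^ (13 / 20 : ℝ) - 2 ^ (13 / 20 : ℝ)) / (13 / 20)) ≤
          3 * (C * Real.log N) * (y ^ (13 / 20 : ℝ) / (13 / 20)) := by gcongr; linarith
        _ ≤ _ := by
            have : 0 ≤ C * Real.log N * y ^ (13 / 20 : ℝ) := by positivity
            linarith
  have b3 : ‖(poleOrder χ : ℂ) * ((2 / Real.log 2 : ℝ) : ℂ)‖ ≤ 3 := by
    have h1 : ‖(poleOrder χ : ℂ)‖ ≤ 1 := by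
      rw [Complex.norm_natCast]
      unfold poleOrder
      split_ifs <;> norm_num
    have h2 : ‖((2 / Real.log 2 : ℝ) : ℂ)‖ ≤ 3 := by
      rw [norm_real, Real.norm_eq_abs, abs_of_nonneg (by positivity), div_le_iff₀ (by linarith)]
      linarith
    rw [norm_mul]
    calc _ ≤ 1 * (3 : ℝ) := mul_le_mul h1 h2 (norm_nonneg _) one_pos.le
      _ = 3 := one_mul _
  rw [hkey]
  refine (norm_add₃_le).trans ((add_le_add (add_le_add b1 b2) b3).trans ?_)
  nlinarith

end PrimeSums

section PrimitiveRoots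

open Complex DirichletCharacter ArithmeticFunction

open scoped ArithmeticFunction.Moebius

theorem sum_abs_moebius_divisors {n : ℕ} (hn : n ≠ 0) :
    ∑ e ∈ n.divisors, |(μ e : ℝ)| = 2 ^ n.primeFactors.card := by
  have h1 : ∀ e : ℕ, |(μ e : ℝ)| = if Squarefree e then 1 else 0 := fun e ↦ by
    rw [← Int.cast_abs, abs_moebius]
    split_ifs <;> simp
  simp only [h1]
  rw [← Finset.sum_filter, Nat.sum_divisors_filter_squarefree hn, Finset.sum_const,
    Finset.card_powerset, nsmul_one]
  rw [Nat.factors_eq]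
  push_cast
  rfl

variable {p : ℕ} [Fact p.Prime]

theorem orderOf_eq_ite_eq_sum_dirichletCharacter (hp : 3 ≤ p) (a : ZMod p) :
    (if orderOf a = p - 1 then (1 : ℂ) else 0) =
      ∑ e ∈ (p - 1).divisors, ∑ χ : DirichletCharacter ℂ p,
        (μ e : ℂ) / ((p : ℂ) - 1) * (χ ^ ((p - 1) / e)) a := by
  have hn : p - 1 ≠ 0 := by omega
  have hpc : ((p - 1 : ℕ) : ℂ) = (p : ℂ) - 1 := by
    rw [Nat.cast_sub (by omega), Nat.cast_one]
  have hpc0 : (p : ℂ) - 1 ≠ 0 := by rw [← hpc]; exact_mod_cast hn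
  have hquot : ∀ e ∈ (p - 1).divisors, (p - 1) / e ≠ 0 := fun e he ↦
    (Nat.div_pos (Nat.divisor_le he) (Nat.pos_of_mem_divisors he)).ne'
  by_cases ha : a = 0
  · subst ha
    rw [if_neg (by rw [orderOf_zero]; omega)]
    symm
    refine Finset.sum_eq_zero fun e he ↦ Finset.sum_eq_zero fun χ _ ↦ ?_
    rw [MulChar.map_zero, mul_zero]
  · have hord : orderOf a ∣ p - 1 := orderOf_dvd_of_pow_eq_one (ZMod.pow_card_sub_one_eq_one ha)
    have hord0 : orderOf a ≠ 0 := fun h ↦ hn (by rwa [h, zero_dvd_iff] at hord)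
    have h1 : ∀ e ∈ (p - 1).divisors, ∑ χ : DirichletCharacter ℂ p,
        (μ e : ℂ) / ((p : ℂ) - 1) * (χ ^ ((p - 1) / e)) a =
        if e ∣ (p - 1) / orderOf a then (μ e : ℂ) else 0 := fun e he ↦ by
      have hed := Nat.dvd_of_mem_divisors he
      simp only [MulChar.pow_apply' _ (hquot e he), ← map_pow]
      rw [← Finset.mul_sum, sum_characters_eq, Nat.totient_prime Fact.out, hpc]
      have h2 : a ^ ((p - 1) / e) = 1 ↔ e ∣ (p - 1) / orderOf a := by
        rw [← orderOf_dvd_iff_pow_eq_one, Nat.dvd_div_iff_mul_dvd hed,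
          Nat.dvd_div_iff_mul_dvd hord, mul_comm]
      simp only [h2]
      split_ifs
      · field_simp
      · simp
    rw [Finset.sum_congr rfl h1, ← Finset.sum_filter]
    have h3 : (p - 1).divisors.filter (· ∣ (p - 1) / orderOf a) =
        ((p - 1) / orderOf a).divisors := by
      ext e
      have := Nat.div_dvd_of_dvd hord
      have h0 : (p - 1) / orderOf a ≠ 0 := Nat.div_ne_zero_iff_of_dvd hord |>.mpr ⟨hn, hord0⟩
      simp only [Finset.mem_filter, Nat.mem_divisors]
      exact ⟨fun h ↦ ⟨h.2, h0⟩, fun h ↦ ⟨⟨h.1.trans this, hn⟩, h.1⟩⟩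
    rw [h3]
    have h4 : ∑ e ∈ ((p - 1) / orderOf a).divisors, μ e =
        if (p - 1) / orderOf a = 1 then 1 else 0 := by
      rw [← coe_mul_zeta_apply, moebius_mul_coe_zeta, one_apply]
    have h5 : (p - 1) / orderOf a = 1 ↔ orderOf a = p - 1 := by
      rw [Nat.div_eq_iff_eq_mul_left (Nat.pos_of_ne_zero hord0) hord, one_mul, eq_comm]
    simp only [h5] at h4
    rw [← Int.cast_sum, h4]
    split_ifs <;> simp

theorem sum_dirichletCharacter_eq (ψ : DirichletCharacter ℂ p) :
    ∑ b : ZMod p, ψ b = poleOrder ψ * ((p : ℂ) - 1) := by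
  unfold poleOrder
  split_ifs with h
  · rw [h, MulChar.sum_one_eq_card_units, ZMod.card_units_eq_totient,
      Nat.totient_prime Fact.out, Nat.cast_sub (Fact.out : p.Prime).one_le]
    simp
  · rw [MulChar.sum_eq_zero_of_ne_one h]
    simp

/-- Detecting primitive roots `q² c` by characters: only the characters whose square is trivial
contribute to the main term. -/
theorem norm_sum_primitiveRoot_sub_le (hp : 3 ≤ p) (s : Finset ℕ) (c : ZMod p) (L B : ℝ)
    (hB : ∀ ψ : DirichletCharacter ℂ p, ‖∑ q ∈ s, ψ q - poleOrder ψ * L‖ ≤ B) :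
    ‖∑ q ∈ s, (if orderOf ((q : ZMod p) ^ 2 * c) = p - 1 then (1 : ℂ) else 0) -
      L / ((p : ℂ) - 1) * ∑ b : ZMod p, (if orderOf (b ^ 2 * c) = p - 1 then (1 : ℂ) else 0)‖ ≤
      2 ^ (p - 1).primeFactors.card * B := by
  have hn : p - 1 ≠ 0 := by omega
  have hpr : ((p - 1 : ℕ) : ℝ) = (p : ℝ) - 1 := by
    rw [Nat.cast_sub (by omega), Nat.cast_one]
  have hpc : ((p - 1 : ℕ) : ℂ) = (p : ℂ) - 1 := by
    rw [Nat.cast_sub (by omega), Nat.cast_one]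
  have hpc0 : (p : ℂ) - 1 ≠ 0 := by rw [← hpc]; exact_mod_cast hn
  have hpr0 : 0 < (p : ℝ) - 1 := by rw [← hpr]; exact_mod_cast Nat.pos_of_ne_zero hn
  have hB0 : 0 ≤ B := (norm_nonneg _).trans (hB 1)
  have hkey : ∑ q ∈ s, (if orderOf ((q : ZMod p) ^ 2 * c) = p - 1 then (1 : ℂ) else 0) -
      L / ((p : ℂ) - 1) * ∑ b : ZMod p, (if orderOf (b ^ 2 * c) = p - 1 then (1 : ℂ) else 0) =
      ∑ e ∈ (p - 1).divisors, ∑ χ : DirichletCharacter ℂ p,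
        (μ e : ℂ) / ((p : ℂ) - 1) * ((χ ^ ((p - 1) / e)) c *
          (∑ q ∈ s, ((χ ^ ((p - 1) / e)) ^ 2) q -
            poleOrder ((χ ^ ((p - 1) / e)) ^ 2) * L)) := by
    have h1 : ∀ (e : ℕ) (χ : DirichletCharacter ℂ p),
        (poleOrder ((χ ^ ((p - 1) / e)) ^ 2) : ℂ) * L =
        L / ((p : ℂ) - 1) * ∑ b : ZMod p, ((χ ^ ((p - 1) / e)) ^ 2) b := fun e χ ↦ by
      rw [sum_dirichletCharacter_eq]
      field_simp
    simp only [orderOf_eq_ite_eq_sum_dirichletCharacter hp, h1, mul_sub, Finset.sum_sub_distrib]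
    congr 1
    · rw [Finset.sum_comm]
      refine Finset.sum_congr rfl fun e _ ↦ ?_
      rw [Finset.sum_comm]
      refine Finset.sum_congr rfl fun χ _ ↦ ?_
      simp only [Finset.mul_sum, map_mul, map_pow, MulChar.pow_apply' _ two_ne_zero]
      exact Finset.sum_congr rfl fun q _ ↦ by ring
    · rw [Finset.sum_comm, Finset.mul_sum]
      refine Finset.sum_congr rfl fun e _ ↦ ?_
      rw [Finset.sum_comm, Finset.mul_sum]
      refine Finset.sum_congr rfl fun χ _ ↦ ?_
      simp only [Finset.mul_sum, map_mul, map_pow, MulChar.pow_apply' _ two_ne_zero]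
      exact Finset.sum_congr rfl fun q _ ↦ by ring
  rw [hkey, ← sum_abs_moebius_divisors hn, Finset.sum_mul]
  refine norm_sum_le_of_le _ fun e _ ↦ ?_
  have hterm : ∀ χ ∈ (Finset.univ : Finset (DirichletCharacter ℂ p)),
      ‖(μ e : ℂ) / ((p : ℂ) - 1) * ((χ ^ ((p - 1) / e)) c *
          (∑ q ∈ s, ((χ ^ ((p - 1) / e)) ^ 2) q -
            poleOrder ((χ ^ ((p - 1) / e)) ^ 2) * L))‖ ≤ |(μ e : ℝ)| / ((p : ℝ) - 1) * B := by
    intro χ _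
    rw [norm_mul, norm_mul, norm_div, norm_intCast, ← hpc, Complex.norm_natCast, hpr]
    have := mul_le_mul ((χ ^ ((p - 1) / e)).norm_le_one c) (hB ((χ ^ ((p - 1) / e)) ^ 2))
      (norm_nonneg _) one_pos.le
    rw [one_mul] at this
    gcongr
  refine (norm_sum_le_of_le _ hterm).trans (le_of_eq ?_)
  rw [Finset.sum_const, Finset.card_univ, ← Nat.card_eq_fintype_card,
    card_eq_totient_of_hasEnoughRootsOfUnity, Nat.totient_prime Fact.out, nsmul_eq_mul, hpr]
  field_simp

end PrimitiveRoots

section Counting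

theorem inv_card_add_one_le_prod_one_sub_inv (P : Finset ℕ) (hP : ∀ l ∈ P, 2 ≤ l) :
    ((P.card : ℝ) + 1)⁻¹ ≤ ∏ l ∈ P, (1 - (l : ℝ)⁻¹) := by
  induction P using Finset.induction_on_max with
  | empty => simp
  | insert a P ha ih =>
    have hnot : a ∉ P := fun h ↦ (ha a h).false
    have ha2 : 2 ≤ a := hP a (Finset.mem_insert_self _ _)
    have hcard : P.card + 2 ≤ a := by
      have : P ⊆ Finset.Ico 2 a := fun l hl ↦
        Finset.mem_Ico.mpr ⟨hP l (Finset.mem_insert_of_mem hl), ha l hl⟩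
      have := Finset.card_le_card this
      rw [Nat.card_Ico] at this
      omega
    rw [Finset.prod_insert hnot, Finset.card_insert_of_notMem hnot]
    have h1 : (P.card : ℝ) + 2 ≤ a := by exact_mod_cast hcard
    have h2 : (a : ℝ)⁻¹ ≤ ((P.card : ℝ) + 2)⁻¹ := inv_anti₀ (by positivity) h1
    have h3 : (((P.card + 1 : ℕ) : ℝ) + 1)⁻¹ =
        (1 - ((P.card : ℝ) + 2)⁻¹) * ((P.card : ℝ) + 1)⁻¹ := by
      push_cast
      field_simp
      ring
    rw [h3]
    refine mul_le_mul (by linarith) (ih fun l hl ↦ hP l (Finset.mem_insert_of_mem hl))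
      (by positivity) ?_
    rw [sub_nonneg]
    exact inv_le_one_of_one_le₀ (by linarith)

theorem card_primeFactors_mul_log_two_le {n : ℕ} (hn : n ≠ 0) :
    (n.primeFactors.card : ℝ) * Real.log 2 ≤ Real.log n := by
  have h1 : 2 ^ n.primeFactors.card ≤ n :=
    (Finset.pow_card_le_prod _ _ _ fun l hl ↦ (Nat.prime_of_mem_primeFactors hl).two_le).trans
      (Nat.le_of_dvd (Nat.pos_of_ne_zero hn) (Nat.prod_primeFactors_dvd n))
  rw [← Real.log_pow]
  exact Real.log_le_log (by positivity) (by exact_mod_cast h1)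

theorem one_le_totient_div_mul_log {p : ℕ} (hp : 3 ≤ p) :
    1 ≤ (Nat.totient (p - 1) : ℝ) / ((p : ℝ) - 1) * (3 * Real.log p) := by
  have hn : p - 1 ≠ 0 := by omega
  have hpr : ((p - 1 : ℕ) : ℝ) = (p : ℝ) - 1 := by
    rw [Nat.cast_sub (by omega), Nat.cast_one]
  have hp3 : (3 : ℝ) ≤ p := by exact_mod_cast hp
  have h1 : (Nat.totient (p - 1) : ℝ) / ((p : ℝ) - 1) =
      ∏ l ∈ (p - 1).primeFactors, (1 - (l : ℝ)⁻¹) := by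
    have := Nat.totient_eq_mul_prod_factors (p - 1)
    have h2 : (Nat.totient (p - 1) : ℝ) =
        ((p - 1 : ℕ) : ℝ) * ∏ l ∈ (p - 1).primeFactors, (1 - (l : ℝ)⁻¹) := by
      have h3 := congrArg (Rat.cast : ℚ → ℝ) this
      rwa [Rat.cast_natCast, Rat.cast_mul, Rat.cast_natCast, Rat.cast_prod,
        Finset.prod_congr rfl fun l _ ↦ by rw [Rat.cast_sub, Rat.cast_one, Rat.cast_inv,
          Rat.cast_natCast]] at h3
    rw [h2, hpr, mul_div_cancel_left₀ _ (by linarith)]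
  have h2 := inv_card_add_one_le_prod_one_sub_inv (p - 1).primeFactors
    fun l hl ↦ (Nat.prime_of_mem_primeFactors hl).two_le
  have h3 := card_primeFactors_mul_log_two_le hn
  have hlog2 : 0.69 < Real.log 2 := lt_trans (by norm_num) Real.log_two_gt_d9
  have hlogp : 1 ≤ Real.log p := by
    rw [Real.le_log_iff_exp_le (by linarith)]
    exact Real.exp_one_lt_d9.le.trans (by linarith)
  have h4 : Real.log ((p - 1 : ℕ) : ℝ) ≤ Real.log p :=
    Real.log_le_log (by rw [hpr]; linarith) (by rw [hpr]; linarith)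
  have hc0 : (0 : ℝ) ≤ ((p - 1).primeFactors.card : ℝ) := Nat.cast_nonneg _
  have h5 : ((p - 1).primeFactors.card : ℝ) + 1 ≤ 3 * Real.log p := by nlinarith
  rw [h1]
  calc (1 : ℝ) = (((p - 1).primeFactors.card : ℝ) + 1)⁻¹ *
        (((p - 1).primeFactors.card : ℝ) + 1) := by field_simp
    _ ≤ _ := mul_le_mul h2 h5 (by positivity) ((by positivity : (0 : ℝ) ≤ _).trans h2)

theorem sum_Icc_rpow_le (R : ℕ) :
    ∑ r ∈ Finset.Icc 1 R, (r : ℝ) ^ (-(39 / 40) : ℝ) ≤ 40 * (R : ℝ) ^ (1 / 40 : ℝ) := by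
  induction R with
  | zero => simp
  | succ R ih =>
    rw [Finset.sum_Icc_succ_top (by omega)]
    set z : ℝ := ((R + 1 : ℕ) : ℝ) with hz
    have hz1 : 1 ≤ z := by rw [hz]; push_cast; linarith [(Nat.cast_nonneg R : (0 : ℝ) ≤ R)]
    have hz0 : 0 < z := by linarith
    have hR : (R : ℝ) = z * (1 + -z⁻¹) := by
      rw [mul_add, mul_neg, mul_inv_cancel₀ hz0.ne', hz]
      push_cast
      ring
    have hzi : z⁻¹ ≤ 1 := inv_le_one_of_one_le₀ hz1
    have h1 : (1 + -z⁻¹) ^ (1 / 40 : ℝ) ≤ 1 + 1 / 40 * -z⁻¹ :=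
      rpow_one_add_le_one_add_mul_self (by linarith) (by norm_num) (by norm_num)
    have h2 : (R : ℝ) ^ (1 / 40 : ℝ) ≤ z ^ (1 / 40 : ℝ) * (1 + 1 / 40 * -z⁻¹) := by
      rw [hR, Real.mul_rpow hz0.le (by linarith)]
      gcongr
    have h3 : z ^ (-(39 / 40) : ℝ) = z ^ (1 / 40 : ℝ) * z⁻¹ := by
      rw [← Real.rpow_neg_one z, ← Real.rpow_add hz0]
      norm_num
    rw [h3]
    linarith

theorem prime_sq_mul_cube_inj {q r q' r' : ℕ} (hq : q.Prime) (hr : r.Prime) (hq' : q'.Prime)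
    (hr' : r'.Prime) (h : q ^ 2 * r ^ 3 = q' ^ 2 * r' ^ 3) : q = q' ∧ r = r' := by
  have key : r = r' := by
    by_contra hne
    have h1 : r = q' := by
      have : r ∣ q' ^ 2 * r' ^ 3 := h ▸ (dvd_pow_self r three_ne_zero).mul_left _
      rcases hr.dvd_mul.mp this with h1 | h1
      · exact (Nat.prime_dvd_prime_iff_eq hr hq').mp (hr.dvd_of_dvd_pow h1)
      · exact absurd ((Nat.prime_dvd_prime_iff_eq hr hr').mp (hr.dvd_of_dvd_pow h1)) hne
    have h2 : r' = q := by
      have : r' ∣ q ^ 2 * r ^ 3 := h ▸ (dvd_pow_self r' three_ne_zero).mul_left _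
      rcases hr'.dvd_mul.mp this with h1 | h1
      · exact (Nat.prime_dvd_prime_iff_eq hr' hq).mp (hr'.dvd_of_dvd_pow h1)
      · exact absurd ((Nat.prime_dvd_prime_iff_eq hr' hr).mp (hr'.dvd_of_dvd_pow h1)).symm hne
    subst h1 h2
    have : r' ^ 2 * r ^ 2 * r = r' ^ 2 * r ^ 2 * r' := by linarith
    exact hne (Nat.eq_of_mul_eq_mul_left (by have := hq.pos; have := hr.pos; positivity) this)
  subst key
  refine ⟨?_, rfl⟩
  have := Nat.eq_of_mul_eq_mul_right (pow_pos hr.pos 3) h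
  exact Nat.pow_left_injective two_ne_zero this

variable {p : ℕ} [Fact p.Prime]

theorem card_orderOf_eq_sub_one (hp : 3 ≤ p) :
    (Finset.univ.filter fun a : ZMod p ↦ orderOf a = p - 1).card = Nat.totient (p - 1) := by
  have hcard : Fintype.card (ZMod p)ˣ = p - 1 := ZMod.card_units p
  rw [← IsCyclic.card_orderOf_eq_totient (α := (ZMod p)ˣ) (d := p - 1) (by
    rw [hcard])]
  symm
  refine Finset.card_bij (fun u _ ↦ (u : ZMod p)) (fun u hu ↦ ?_) (fun u _ v _ h ↦ Units.ext h)
    fun a ha ↦ ?_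
  · simpa [orderOf_units] using hu
  · have h1 : orderOf a = p - 1 := by simpa using ha
    have h0 : a ≠ 0 := by
      rintro rfl
      rw [orderOf_zero] at h1
      omega
    exact ⟨Units.mk0 a h0, by simpa [← orderOf_units] using h1, rfl⟩

theorem quadraticChar_eq_neg_one_of_orderOf_eq (hp : 3 ≤ p) {a : ZMod p}
    (ha : orderOf a = p - 1) : quadraticChar (ZMod p) a = -1 := by
  rw [quadraticChar_neg_one_iff_not_isSquare]
  rintro ⟨t, rfl⟩
  have ht : t ≠ 0 := by
    rintro rfl
    rw [mul_zero, orderOf_zero] at ha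
    omega
  have hodd : Odd p := (Fact.out : p.Prime).odd_of_ne_two (by omega)
  obtain ⟨k, rfl⟩ := hodd
  have h1 : (t * t) ^ k = 1 := by
    rw [← pow_two, ← pow_mul]
    exact ZMod.pow_card_sub_one_eq_one ht
  have := Nat.le_of_dvd (by omega) (orderOf_dvd_of_pow_eq_one h1)
  omega

theorem card_sq_mul_cube_orderOf_eq (hp : 3 ≤ p) (r : ZMod p) (hr : r ≠ 0) :
    ((Finset.univ.filter fun b : ZMod p ↦ orderOf (b ^ 2 * r ^ 3) = p - 1).card : ℤ) =
      Nat.totient (p - 1) * (1 - quadraticChar (ZMod p) r) := by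
  have hchar : ringChar (ZMod p) ≠ 2 := by rw [ZMod.ringChar_zmod_n]; omega
  set A := Finset.univ.filter fun a : ZMod p ↦ orderOf a = p - 1 with hA
  have h1 := Finset.card_eq_sum_card_fiberwise (f := fun b : ZMod p ↦ b ^ 2 * r ^ 3)
    (s := Finset.univ.filter fun b : ZMod p ↦ orderOf (b ^ 2 * r ^ 3) = p - 1) (t := A)
    (fun b hb ↦ by simpa [hA] using hb)
  rw [h1, ← card_orderOf_eq_sub_one hp, Nat.cast_sum, ← nsmul_eq_mul]
  refine (Finset.sum_congr rfl fun a ha ↦ ?_).trans (Finset.sum_const _)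
  have ha' : orderOf a = p - 1 := (Finset.mem_filter.mp ha).2
  have h2 : ((Finset.univ.filter fun b : ZMod p ↦ orderOf (b ^ 2 * r ^ 3) = p - 1).filter
      fun b ↦ b ^ 2 * r ^ 3 = a).card = {x : ZMod p | x ^ 2 = a * r}.toFinset.card := by
    refine Finset.card_bij (fun b _ ↦ b * r ^ 2) (fun b hb ↦ ?_) (fun b _ c _ h ↦ ?_)
      fun x hx ↦ ?_
    · have := (Finset.mem_filter.mp hb).2
      simp only [Set.mem_toFinset, Set.mem_ofPred_eq]
      rw [← this]
      ring
    · exact mul_right_cancel₀ (pow_ne_zero 2 hr) h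
    · simp only [Set.mem_toFinset, Set.mem_ofPred_eq] at hx
      have h3 : (x / r ^ 2) ^ 2 * r ^ 3 = a := by
        field_simp
        linear_combination hx
      exact ⟨x / r ^ 2, by simp [h3, ha'], by field_simp⟩
  rw [h2, quadraticChar_card_sqrts hchar, map_mul,
    quadraticChar_eq_neg_one_of_orderOf_eq hp ha']
  ring

end Counting

section FinalCount

open DirichletCharacter

theorem sq_mul_cube_le_iff {x : ℝ} (hx : 0 ≤ x) {q r : ℕ} (hr : 0 < r) :
    (q : ℝ) ^ 2 * (r : ℝ) ^ 3 ≤ x ↔ (q : ℝ) ≤ x ^ ((1 : ℝ) / 2) / (r : ℝ) ^ ((3 : ℝ) / 2) := by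
  have hr0 : (0 : ℝ) < r := by exact_mod_cast hr
  have h1 : (x ^ ((1 : ℝ) / 2) / (r : ℝ) ^ ((3 : ℝ) / 2)) ^ 2 = x / (r : ℝ) ^ 3 := by
    rw [div_pow, ← Real.rpow_natCast, ← Real.rpow_natCast (_ ^ _), ← Real.rpow_mul hx,
      ← Real.rpow_mul hr0.le]
    norm_num
  rw [← pow_le_pow_iff_left₀ (a := (q : ℝ)) (Nat.cast_nonneg q) (by positivity) two_ne_zero, h1,
    le_div_iff₀ (by positivity)]

theorem le_floor_rpow_of_cube_le {x : ℝ} {r : ℕ} (h : (r : ℝ) ^ 3 ≤ x) :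
    r ≤ ⌊x ^ ((1 : ℝ) / 3)⌋₊ := by
  refine Nat.le_floor ?_
  calc (r : ℝ) = ((r : ℝ) ^ 3) ^ ((1 : ℝ) / 3) := by
        rw [← Real.rpow_natCast, ← Real.rpow_mul (Nat.cast_nonneg r)]
        norm_num
    _ ≤ _ := Real.rpow_le_rpow (by positivity) h (by norm_num)

open Classical in
theorem card_memS_filter_eq_sum {p : ℕ} {x : ℝ} (hx : 0 ≤ x) :
    ((Finset.Icc 1 ⌊x⌋₊).filter (fun m => memS m ∧ orderOf (m : ZMod p) = p - 1)).card =
      ∑ r ∈ (Finset.Iic ⌊x ^ ((1 : ℝ) / 3)⌋₊).filter Nat.Prime,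
        ∑ q ∈ Finset.Icc 0 ⌊x ^ ((1 : ℝ) / 2) / (r : ℝ) ^ ((3 : ℝ) / 2)⌋₊ with q.Prime,
          if orderOf ((q : ZMod p) ^ 2 * (r : ZMod p) ^ 3) = p - 1 then 1 else 0 := by
  simp only [← Finset.card_filter]
  rw [← Finset.card_sigma]
  symm
  refine Finset.card_bij (fun a _ ↦ a.2 ^ 2 * a.1 ^ 3) (fun a ha ↦ ?_) (fun a ha b hb h ↦ ?_)
    fun m hm ↦ ?_
  · simp only [Finset.mem_sigma, Finset.mem_filter, Finset.mem_Iic, Finset.mem_Icc, zero_le,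
      true_and] at ha
    obtain ⟨⟨-, hr⟩, ⟨hq, hqp⟩, ho⟩ := ha
    have h1 := (sq_mul_cube_le_iff hx hr.pos).mpr ((Nat.le_floor_iff (by positivity)).mp hq)
    simp only [Finset.mem_filter, Finset.mem_Icc]
    refine ⟨⟨Nat.mul_pos (pow_pos hqp.pos 2) (pow_pos hr.pos 3), Nat.le_floor ?_⟩,
      ⟨a.2, a.1, hqp, hr, rfl⟩, ?_⟩
    · exact_mod_cast h1
    · exact_mod_cast ho
  · simp only [Finset.mem_sigma, Finset.mem_filter] at ha hb
    obtain ⟨h1, h2⟩ := prime_sq_mul_cube_inj ha.2.1.2 ha.1.2 hb.2.1.2 hb.1.2 h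
    exact Sigma.ext h2 (heq_of_eq h1)
  · simp only [Finset.mem_filter, Finset.mem_Icc] at hm
    obtain ⟨⟨-, hmx⟩, ⟨q, r, hq, hr, rfl⟩, ho⟩ := hm
    have h1 : (q : ℝ) ^ 2 * (r : ℝ) ^ 3 ≤ x := by exact_mod_cast (Nat.le_floor_iff hx).mp hmx
    have h2 : (1 : ℝ) ≤ (q : ℝ) ^ 2 := one_le_pow₀ (by exact_mod_cast hq.one_le)
    have h3 : (r : ℝ) ^ 3 ≤ x := (le_mul_of_one_le_left (by positivity) h2).trans h1
    refine ⟨⟨r, q⟩, ?_, rfl⟩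
    simp only [Finset.mem_sigma, Finset.mem_filter, Finset.mem_Iic, Finset.mem_Icc, zero_le,
      true_and]
    exact ⟨⟨le_floor_rpow_of_cube_le h3, hr⟩,
      ⟨Nat.le_floor ((sq_mul_cube_le_iff hx hr.pos).mp h1), hq⟩, by exact_mod_cast ho⟩

theorem sum_rpow_div_rpow_le {x : ℝ} (hx : 0 < x) :
    ∑ r ∈ (Finset.Iic ⌊x ^ ((1 : ℝ) / 3)⌋₊).filter Nat.Prime,
      (x ^ ((1 : ℝ) / 2) / (r : ℝ) ^ ((3 : ℝ) / 2)) ^ (13 / 20 : ℝ) ≤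
        40 * x ^ ((1 : ℝ) / 3) := by
  have hz : (0 : ℝ) ≤ x ^ ((1 : ℝ) / 3) := by positivity
  have hfl : (⌊x ^ ((1 : ℝ) / 3)⌋₊ : ℝ) ≤ x ^ ((1 : ℝ) / 3) := Nat.floor_le hz
  calc _ ≤ ∑ r ∈ Finset.Icc 1 ⌊x ^ ((1 : ℝ) / 3)⌋₊,
        x ^ (13 / 40 : ℝ) * (r : ℝ) ^ (-(39 / 40) : ℝ) := by
        refine (Finset.sum_le_sum fun r hr ↦ ?_).trans
          (Finset.sum_le_sum_of_subset_of_nonneg (fun r hr ↦ ?_) fun r _ _ ↦ by positivity)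
        · rw [Real.div_rpow (by positivity) (by positivity), ← Real.rpow_mul hx.le,
            ← Real.rpow_mul (Nat.cast_nonneg r), div_eq_mul_inv,
            ← Real.rpow_neg (Nat.cast_nonneg r)]
          norm_num
        · have h := Finset.mem_filter.mp hr
          exact Finset.mem_Icc.mpr ⟨h.2.one_le, Finset.mem_Iic.mp h.1⟩
    _ ≤ x ^ (13 / 40 : ℝ) * (40 * (x ^ ((1 : ℝ) / 3)) ^ (1 / 40 : ℝ)) := by
        rw [← Finset.mul_sum]
        gcongr
        refine (sum_Icc_rpow_le _).trans ?_
        gcongr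
    _ = 40 * (x ^ (13 / 40 : ℝ) * x ^ ((1 : ℝ) / 3 * (1 / 40))) := by
        rw [Real.rpow_mul hx.le]
        ring
    _ = _ := by
        rw [← Real.rpow_add hx]
        norm_num

theorem totient_mul_sub_legendreSym_eq {p : ℕ} [Fact p.Prime] (hp : 3 ≤ p) (r : ℕ) :
    (Nat.totient (p - 1) : ℝ) *
      ((1 : DirichletCharacter ℝ p) (r : ZMod p) - (legendreSym p r : ℝ)) =
      ∑ b : ZMod p, if orderOf (b ^ 2 * (r : ZMod p) ^ 3) = p - 1 then (1 : ℝ) else 0 := by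
  rw [← Finset.sum_filter, Finset.sum_const, nsmul_one]
  by_cases hr : (r : ZMod p) = 0
  · have h1 : (Finset.univ.filter fun b : ZMod p ↦
        orderOf (b ^ 2 * (r : ZMod p) ^ 3) = p - 1) = ∅ := by
      refine Finset.filter_eq_empty_iff.mpr fun b _ ↦ ?_
      rw [hr, zero_pow three_ne_zero, mul_zero, orderOf_zero]
      omega
    rw [h1, Finset.card_empty, hr, MulChar.map_zero, legendreSym, Int.cast_natCast, hr,
      MulChar.map_zero]
    simp
  · have h1 := card_sq_mul_cube_orderOf_eq hp (r : ZMod p) hr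
    rw [MulChar.one_apply (isUnit_iff_ne_zero.mpr hr), legendreSym, Int.cast_natCast]
    exact_mod_cast h1.symm

end FinalCount

open Classical in
/-- Theorem 2: assuming GRH mod `p`, the number `N_S(p,x)` of members of `S` up to `x` that are
primitive roots mod `p` equals
`(φ(p-1)/(p-1)) ∑_{r ≤ x^(1/3) prime} (χ₀(r) - χ₂(r)) Li(x^(1/2)/r^(3/2))`
up to an error `O((φ(p-1)/(p-1)) 2^(ω(p-1)) x^(1/3) (log(px))²)`. -/
theorem S_primitive_root_count_GRH :
    ∃ C : ℝ, 0 < C ∧ ∀ (p : ℕ) [Fact p.Prime], Odd p →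
      (∀ ψ : DirichletCharacter ℂ p, ∀ s : ℂ,
        DirichletCharacter.LFunction ψ s = 0 → 0 < s.re → s.re < 1 → s.re = 1/2) →
      ∀ x : ℝ, 8 ≤ x →
        |(((Finset.Icc 1 ⌊x⌋₊).filter
              (fun m => memS m ∧ orderOf (m : ZMod p) = p - 1)).card : ℝ)
            - ((Nat.totient (p - 1) : ℝ) / ((p : ℝ) - 1))
              * ∑ r ∈ Finset.Iic ⌊x ^ ((1 : ℝ)/3)⌋₊ |>.filter Nat.Prime,
                  ((1 : DirichletCharacter ℝ p) (r : ZMod p) - (legendreSym p r : ℝ))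
                    * Li (x ^ ((1 : ℝ)/2) / (r : ℝ) ^ ((3 : ℝ)/2))|
          ≤ C * ((Nat.totient (p - 1) : ℝ) / ((p : ℝ) - 1)) * 2 ^ (p - 1).primeFactors.card
              * x ^ ((1 : ℝ)/3) * (Real.log ((p : ℝ) * x)) ^ 2 := by
  obtain ⟨C, hC0, hC⟩ := exists_norm_sum_prime_sub_le
  refine ⟨120 * C, by positivity, fun p _ hodd hGRH x hx ↦ ?_⟩
  have hp : 3 ≤ p := by
    have := (Fact.out : p.Prime).two_le
    rcases hodd with ⟨k, rfl⟩
    omega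
  have hp3 : (3 : ℝ) ≤ p := by exact_mod_cast hp
  have hx0 : 0 < x := by linarith
  set R := (Finset.Iic ⌊x ^ ((1 : ℝ) / 3)⌋₊).filter Nat.Prime with hR
  set y : ℕ → ℝ := fun r ↦ x ^ ((1 : ℝ) / 2) / (r : ℝ) ^ ((3 : ℝ) / 2) with hy
  set W : ℝ := 2 ^ (p - 1).primeFactors.card with hW
  have hterm : ∀ r ∈ R, ‖∑ q ∈ Finset.Icc 0 ⌊y r⌋₊ with q.Prime,
      (if orderOf ((q : ZMod p) ^ 2 * (r : ZMod p) ^ 3) = p - 1 then (1 : ℂ) else 0) -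
      Li (y r) / ((p : ℂ) - 1) * ∑ b : ZMod p,
        (if orderOf (b ^ 2 * (r : ZMod p) ^ 3) = p - 1 then (1 : ℂ) else 0)‖ ≤
      W * (C * Real.log p) * y r ^ (13 / 20 : ℝ) := fun r hr ↦ by
    have hr0 : (0 : ℝ) < r := by exact_mod_cast (Finset.mem_filter.mp hr).2.pos
    rw [mul_assoc W]
    exact norm_sum_primitiveRoot_sub_le hp _ _ _ _ fun ψ ↦
      hC p ψ hp (hGRH ψ) (y r) (by positivity)
  have hkey : ‖∑ r ∈ R, (∑ q ∈ Finset.Icc 0 ⌊y r⌋₊ with q.Prime,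
      (if orderOf ((q : ZMod p) ^ 2 * (r : ZMod p) ^ 3) = p - 1 then (1 : ℂ) else 0) -
      Li (y r) / ((p : ℂ) - 1) * ∑ b : ZMod p,
        (if orderOf (b ^ 2 * (r : ZMod p) ^ 3) = p - 1 then (1 : ℂ) else 0))‖ ≤
      W * (C * Real.log p) * (40 * x ^ ((1 : ℝ) / 3)) := by
    refine (norm_sum_le_of_le _ hterm).trans ?_
    have hl : 0 ≤ Real.log p := Real.log_nonneg (by linarith)
    rw [← Finset.mul_sum]
    gcongr
    exact sum_rpow_div_rpow_le hx0
  have hmain : (Nat.totient (p - 1) : ℝ) / ((p : ℝ) - 1) * ∑ r ∈ R,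
      ((1 : DirichletCharacter ℝ p) (r : ZMod p) - (legendreSym p r : ℝ)) * Li (y r) =
      ∑ r ∈ R, Li (y r) / ((p : ℝ) - 1) * ∑ b : ZMod p,
        (if orderOf (b ^ 2 * (r : ZMod p) ^ 3) = p - 1 then (1 : ℝ) else 0) := by
    rw [Finset.mul_sum]
    refine Finset.sum_congr rfl fun r _ ↦ ?_
    rw [← totient_mul_sub_legendreSym_eq hp]
    ring
  rw [hmain, card_memS_filter_eq_sum hx0.le, ← Real.norm_eq_abs, ← Complex.norm_real]
  push_cast
  simp only [apply_ite Complex.ofReal,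
    Complex.ofReal_one, Complex.ofReal_zero]
  rw [← Finset.sum_sub_distrib]
  refine hkey.trans ?_
  have h1 := one_le_totient_div_mul_log hp
  have hlp : 0 ≤ Real.log p := Real.log_nonneg (by linarith)
  have hlpx : Real.log p ≤ Real.log (p * x) :=
    Real.log_le_log (by linarith) (le_mul_of_one_le_right (by linarith) (by linarith))
  have hφ : 0 ≤ (Nat.totient (p - 1) : ℝ) / ((p : ℝ) - 1) :=
    div_nonneg (Nat.cast_nonneg _) (by linarith)
  calc W * (C * Real.log p) * (40 * x ^ ((1 : ℝ) / 3)) =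
      40 * C * W * x ^ ((1 : ℝ) / 3) * Real.log p * 1 := by ring
    _ ≤ 40 * C * W * x ^ ((1 : ℝ) / 3) * Real.log p *
        ((Nat.totient (p - 1) : ℝ) / ((p : ℝ) - 1) * (3 * Real.log p)) := by gcongr
    _ = 120 * C * ((Nat.totient (p - 1) : ℝ) / ((p : ℝ) - 1)) * W * x ^ ((1 : ℝ) / 3) *
        Real.log p ^ 2 := by ring
    _ ≤ _ := by gcongr
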